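/- For every n ∈ ℕ (n ≥ 1), the Vietoris hyperspace ℱₙ(𝔈) of nonempty subsets of Erdős space 𝔈 of cardinality at most n is homeomorphic to 𝔈. -/

import Mathlib

open Set Topology Filter

/-- The Vietoris topology on `Set X` induced by a topology `t` on `X`, generated by the
subbasic sets `{F | F ⊆ U}` and `{F | F ∩ U ≠ ∅}` for `U` open in `t`. -/
def vietoris {X : Type*} (t : TopologicalSpace X) : TopologicalSpace (Set X) :=
  TopologicalSpace.generateFrom
    {S | (∃ U : Set X, IsOpen[t] U ∧ S = {F : Set X | F ⊆ U}) ∨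
         (∃ U : Set X, IsOpen[t] U ∧ S = {F : Set X | (F ∩ U).Nonempty})}

/-- `ℱₙ(X)`: the hyperspace of nonempty subsets of `X` of cardinality at most `n`. -/
def FinHypN (n : ℕ) (X : Type*) : Type _ := {F : Set X // F.Nonempty ∧ F.encard ≤ n}

noncomputable instance FinHypN.instCoeOut {n : ℕ} {X : Type*} : CoeOut (FinHypN n X) (Set X) :=
  ⟨Subtype.val⟩

/-- `ℱₙ(X)` carries the (subspace) Vietoris topology. -/
instance FinHypN.instTopologicalSpace {n : ℕ} {X : Type*} [t : TopologicalSpace X] :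
    TopologicalSpace (FinHypN n X) :=
  (vietoris t).induced Subtype.val

/-- Erdős space: the set of square-summable sequences of rationals, as a subspace of the
real Hilbert space `ℓ²`. -/
noncomputable abbrev ErdosSpace : Type :=
  {x : lp (fun _ : ℕ => ℝ) 2 // ∀ n : ℕ, ∃ q : ℚ, x n = (q : ℝ)}

/-- Splitting a punctured clopen set into a sequence of nonempty clopen sets shrinking to the
removed point. -/
theorem exists_clopen_sequence_of_clopen {X : Type*} [MetricSpace X] [Countable X]
    (hX : ∀ x : X, (𝓝[≠] x).NeBot) {U : Set X} (hU : IsClopen U) {p : X} (hp : p ∈ U) :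
    ∃ V : ℕ → Set X, (∀ k, IsClopen (V k) ∧ (V k).Nonempty) ∧ Pairwise (Function.onFun Disjoint V) ∧
      ⋃ k, V k = U \ {p} ∧ ∀ O ∈ 𝓝 p, ∃ N, ∀ k ≥ N, V k ⊆ O := by
  have hball : ∀ ε > 0, ∃ W : Set X, IsClopen W ∧ p ∈ W ∧ W ⊆ Metric.ball p ε := by
    intro ε hε
    have hc : (Ioo 0 ε \ range fun x : X => dist x p).Nonempty := by
      by_contra h
      rw [not_nonempty_iff_eq_empty, sdiff_eq_empty] at h
      exact (Cardinal.Real.Ioo_countable_iff.not.2 (by simpa using hε))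
        ((countable_range _).mono h)
    obtain ⟨r, ⟨hr0, hrε⟩, hr⟩ := hc
    refine ⟨Metric.ball p r, ⟨?_, Metric.isOpen_ball⟩, Metric.mem_ball_self hr0,
      Metric.ball_subset_ball hrε.le⟩
    have : Metric.ball p r = Metric.closedBall p r := by
      ext x
      simp only [Metric.mem_ball, Metric.mem_closedBall]
      exact ⟨le_of_lt, fun h => lt_of_le_of_ne h fun h' => hr ⟨x, h'⟩⟩
    rw [this]
    exact Metric.isClosed_closedBall
  have hstep : ∀ (k : ℕ) (W : {W : Set X // IsClopen W ∧ p ∈ W}),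
      ∃ W' : {W : Set X // IsClopen W ∧ p ∈ W}, W'.1 ⊆ W.1 ∧
        W'.1 ⊆ Metric.ball p (1 / (k + 1 : ℝ)) ∧ (W.1 \ W'.1).Nonempty := by
    rintro k ⟨W, hW, hpW⟩
    have := hX p
    obtain ⟨y, hyW, hyp⟩ : (W ∩ {p}ᶜ).Nonempty :=
      (inter_mem (mem_nhdsWithin_of_mem_nhds (hW.isOpen.mem_nhds hpW))
        self_mem_nhdsWithin : W ∩ {p}ᶜ ∈ 𝓝[≠] p) |> fun h => Filter.nonempty_of_mem h
    have hd : 0 < dist y p := dist_pos.2 hyp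
    obtain ⟨B, hB, hpB, hBs⟩ := hball (min (1 / (k + 1 : ℝ)) (dist y p))
      (lt_min (by positivity) hd)
    refine ⟨⟨W ∩ B, hW.inter hB, hpW, hpB⟩, inter_subset_left,
      fun x hx => Metric.ball_subset_ball (min_le_left _ _) (hBs hx.2), y, hyW, fun h => ?_⟩
    have := Metric.ball_subset_ball (min_le_right _ _) (hBs h.2)
    simp at this
  choose next h₁ h₂ h₃ using hstep
  let W : ℕ → {W : Set X // IsClopen W ∧ p ∈ W} :=
    fun k => Nat.rec ⟨U, hU, hp⟩ (fun k W => next k W) k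
  have hanti : Antitone fun k => (W k).1 := antitone_nat_of_succ_le fun k => h₁ k (W k)
  refine ⟨fun k => (W k).1 \ (W (k + 1)).1, fun k => ⟨(W k).2.1.diff (W (k + 1)).2.1, h₃ k (W k)⟩,
    ?_, ?_, ?_⟩
  · refine (pairwise_disjoint_on _).2 fun a b hab => ?_
    rw [Set.disjoint_left]
    rintro x ⟨-, hx⟩ ⟨hx', -⟩
    exact hx (hanti (Nat.succ_le_of_lt hab) hx')
  · ext x
    simp only [mem_iUnion, Set.mem_sdiff, mem_singleton_iff]
    constructor
    · rintro ⟨k, hk, hk'⟩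
      exact ⟨hanti (Nat.zero_le k) hk, fun h => hk' (h ▸ (W (k + 1)).2.2)⟩
    · rintro ⟨hxU, hxp⟩
      have hex : ∃ k, x ∉ (W k).1 := by
        obtain ⟨k, hk⟩ := exists_nat_one_div_lt (dist_pos.2 hxp)
        refine ⟨k + 1, fun h => ?_⟩
        have := h₂ k (W k) h
        rw [Metric.mem_ball] at this
        linarith
      classical
      have hk := Nat.find_spec hex
      rcases hm : Nat.find hex with _ | m
      · rw [hm] at hk
        exact absurd hxU hk
      · rw [hm] at hk
        refine ⟨m, ?_, hk⟩
        by_contra h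
        have := Nat.find_min' hex h
        omega
  · intro O hO
    obtain ⟨ε, hε, hεO⟩ := Metric.mem_nhds_iff.1 hO
    obtain ⟨N, hN⟩ := exists_nat_one_div_lt hε
    refine ⟨N + 1, fun k hk x hx => hεO ?_⟩
    exact Metric.ball_subset_ball hN.le (h₂ N (W N) (hanti hk hx.1))

/-- A nonempty countable metric space without isolated points is coded by the finite sequences of
natural numbers, in such a way that the coding determines the topology. -/
theorem exists_list_coding {X : Type*} [MetricSpace X] [Countable X] [Nonempty X]
    (hX : ∀ x : X, (𝓝[≠] x).NeBot) :
    ∃ e : List ℕ ≃ X, ∀ s, (𝓝 (e s)).HasBasis (fun _ : ℕ => True)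
      fun N => e '' {t | t = s ∨ ∃ k ≥ N, (k :: s) <:+ t} := by
  obtain ⟨f, hf⟩ := exists_injective_nat X
  let p : {U : Set X // IsClopen U ∧ U.Nonempty} → X := fun U =>
    Function.argminOn f U.1 U.2.2
  have hpU : ∀ U, p U ∈ U.1 := fun U => Function.argminOn_mem f U.1 U.2.2
  have hpmin : ∀ U, ∀ x ∈ U.1, f (p U) ≤ f x := fun U x hx => Function.argminOn_le f U.1 hx
  choose V hV hVd hVU hVn using fun U : {U : Set X // IsClopen U ∧ U.Nonempty} =>
    exists_clopen_sequence_of_clopen hX U.2.1 (hpU U)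
  let D : List ℕ → {U : Set X // IsClopen U ∧ U.Nonempty} := fun s =>
    List.rec ⟨univ, isClopen_univ, univ_nonempty⟩ (fun k _ U => ⟨V U k, hV U k⟩) s
  have hDcons : ∀ k s, (D (k :: s)).1 = V (D s) k := fun k s => rfl
  have hDsub : ∀ k s, (D (k :: s)).1 ⊆ (D s).1 \ {p (D s)} := fun k s => by
    rw [← hVU (D s), hDcons]
    exact subset_iUnion _ k
  have hmono : ∀ l s, (D (l ++ s)).1 ⊆ (D s).1 := by
    intro l s
    induction l with
    | nil => exact Subset.rfl
    | cons a l ih => exact (hDsub a (l ++ s)).trans (sdiff_subset.trans ih)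
  have hmono' : ∀ {s t}, s <:+ t → (D t).1 ⊆ (D s).1 := by
    rintro s t ⟨l, rfl⟩
    exact hmono l s
  have hproper : ∀ {s t : List ℕ}, s <:+ t → s ≠ t → ∃ c, (c :: s) <:+ t := by
    rintro s t ⟨l, rfl⟩ hne
    rcases List.eq_nil_or_concat l with rfl | ⟨l', c, rfl⟩
    · simp at hne
    · exact ⟨c, l', by simp⟩
  have hcomp : ∀ s t x, x ∈ (D s).1 → x ∈ (D t).1 → s <:+ t ∨ t <:+ s := by
    intro s
    induction s with
    | nil => exact fun t x _ _ => Or.inl List.nil_suffix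
    | cons a s ih =>
      intro t x hxs hxt
      rcases ih t x (hDsub a s hxs).1 hxt with h | h
      · by_cases hst : s = t
        · exact Or.inr (hst ▸ List.suffix_cons a s)
        · obtain ⟨c, hc⟩ := hproper h hst
          have hxc : x ∈ (D (c :: s)).1 := hmono' hc hxt
          have : c = a := by
            by_contra hca
            exact (Set.disjoint_left.1 (hVd (D s) hca)) hxc hxs
          exact Or.inl (this ▸ hc)
      · exact Or.inr (h.trans (List.suffix_cons a s))
  have hinj : Function.Injective fun s => p (D s) := by
    have key : ∀ s t, s <:+ t → p (D s) = p (D t) → s = t := by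
      intro s t hst h
      by_contra hne
      obtain ⟨c, hc⟩ := hproper hst hne
      exact (hDsub c s (hmono' hc (hpU (D t)))).2 h.symm
    intro s t h
    rcases hcomp s t (p (D s)) (hpU _) (by simpa only [h] using hpU (D t)) with h' | h'
    · exact key s t h' h
    · exact (key t s h' h.symm).symm
  have hsurj : ∀ n s x, x ∈ (D s).1 → f x - f (p (D s)) ≤ n → ∃ t, s <:+ t ∧ p (D t) = x := by
    intro n
    induction n with
    | zero =>
      intro s x hx hn
      exact ⟨s, List.suffix_rfl, hf (le_antisymm (hpmin _ x hx) (by omega))⟩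
    | succ n ih =>
      intro s x hx hn
      by_cases hxs : x = p (D s)
      · exact ⟨s, List.suffix_rfl, hxs.symm⟩
      have hx' : x ∈ ⋃ k, V (D s) k := by
        rw [hVU]
        exact ⟨hx, hxs⟩
      obtain ⟨k, hk⟩ := mem_iUnion.1 hx'
      have hk' : x ∈ (D (k :: s)).1 := hk
      have h1 := hDsub k s (hpU (D (k :: s)))
      have h2 : f (p (D s)) ≠ f (p (D (k :: s))) := fun h => h1.2 (hf h).symm
      have h3 := hpmin (D s) _ h1.1
      have h4 := hpmin _ x hk'
      obtain ⟨t, ht, htx⟩ := ih (k :: s) x hk' (by omega)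
      exact ⟨t, (List.suffix_cons k s).trans ht, htx⟩
  let e : List ℕ ≃ X := Equiv.ofBijective _ ⟨hinj, fun x => by
    obtain ⟨t, -, ht⟩ := hsurj _ [] x (mem_univ x) le_rfl
    exact ⟨t, ht⟩⟩
  have he : ∀ s, e s = p (D s) := fun s => rfl
  have heD : ∀ s, e '' {t | s <:+ t} = (D s).1 := by
    intro s
    ext x
    constructor
    · rintro ⟨t, ht, rfl⟩
      exact hmono' ht (hpU _)
    · intro hx
      obtain ⟨t, ht, htx⟩ := hsurj _ s x hx le_rfl
      exact ⟨t, ht, htx⟩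
  refine ⟨e, fun s => ⟨fun O => ?_⟩⟩
  simp only [true_and]
  constructor
  · intro hO
    obtain ⟨N, hN⟩ := hVn (D s) O hO
    refine ⟨N, ?_⟩
    rintro _ ⟨t, rfl | ⟨k, hk, hkt⟩, rfl⟩
    · exact mem_of_mem_nhds hO
    · refine hN k hk ?_
      rw [← hDcons]
      exact hmono' hkt (hpU _)
  · rintro ⟨N, hN⟩
    have hopen : IsOpen ((D s).1 \ ⋃ k ∈ Finset.range N, (D (k :: s)).1) :=
      (D s).2.1.isOpen.sdiff (isClosed_biUnion_finset fun k _ => (D (k :: s)).2.1.isClosed)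
    refine mem_of_superset (hopen.mem_nhds ⟨hpU _, ?_⟩) (Subset.trans ?_ hN)
    · simp only [mem_iUnion, not_exists]
      intro k _ h
      exact (hDsub k s h).2 rfl
    · rintro x ⟨hx, hxN⟩
      rw [← heD] at hx
      obtain ⟨t, ht, rfl⟩ := hx
      refine ⟨t, ?_, rfl⟩
      by_cases hst : s = t
      · exact Or.inl hst.symm
      · obtain ⟨c, hc⟩ := hproper ht hst
        refine Or.inr ⟨c, ?_, hc⟩
        by_contra hcN
        exact hxN (mem_iUnion₂.2 ⟨c, by simpa using hcN, hmono' hc (hpU _)⟩)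

/-- **Sierpiński's theorem**: a nonempty countable metrizable space without isolated points is
homeomorphic to the rationals. -/
theorem nonempty_homeomorph_rat {X : Type*} [TopologicalSpace X] [TopologicalSpace.MetrizableSpace X]
    [Countable X] [Nonempty X] (hX : ∀ x : X, (𝓝[≠] x).NeBot) : Nonempty (X ≃ₜ ℚ) := by
  let := TopologicalSpace.metrizableSpaceMetric X
  obtain ⟨e, he⟩ := exists_list_coding hX
  obtain ⟨e', he'⟩ := exists_list_coding (X := ℚ) fun x => inferInstance
  refine ⟨⟨e.symm.trans e', ?_, ?_⟩⟩
  · refine continuous_iff_continuousAt.2 fun x => ?_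
    obtain ⟨s, rfl⟩ := e.surjective x
    refine ((he s).tendsto_iff (by simpa using he' s)).2 fun N _ => ⟨N, trivial, ?_⟩
    rintro _ ⟨t, ht, rfl⟩
    exact ⟨t, ht, by simp⟩
  · refine continuous_iff_continuousAt.2 fun x => ?_
    obtain ⟨s, rfl⟩ := e'.surjective x
    refine ((he' s).tendsto_iff (by simpa using he s)).2 fun N _ => ⟨N, trivial, ?_⟩
    rintro _ ⟨t, ht, rfl⟩
    exact ⟨t, ht, by simp⟩

namespace ErdosSpace

theorem sum_reindex_le (f : ℕ → Option ℕ) (hf : ∀ s t u, f s = some u → f t = some u → s = t)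
    (x : lp (fun _ : ℕ => ℝ) 2) (s : Finset ℕ) :
    ∑ t ∈ s, ‖(f t).elim (0 : ℝ) x‖ ^ (2 : ENNReal).toReal ≤ ‖x‖ ^ (2 : ENNReal).toReal := by
  have h1 : ∑ t ∈ s, ‖(f t).elim (0 : ℝ) x‖ ^ (2 : ENNReal).toReal =
      ∑ t ∈ s with (f t).isSome, ‖x ((f t).getD 0)‖ ^ (2 : ENNReal).toReal := by
    rw [Finset.sum_filter]
    refine Finset.sum_congr rfl fun t _ => ?_
    cases f t <;> simp
  have h2 : Set.InjOn (fun t => (f t).getD 0) (s.filter fun t => (f t).isSome) := by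
    intro a ha b hb hab
    simp only [Finset.coe_filter, Set.mem_ofPred_eq, Option.isSome_iff_exists] at ha hb
    obtain ⟨-, u, hu⟩ := ha
    obtain ⟨-, v, hv⟩ := hb
    simp only [hu, hv, Option.getD_some] at hab
    exact hf a b u hu (hab ▸ hv)
  rw [h1, ← Finset.sum_image (f := fun u => ‖x u‖ ^ (2 : ENNReal).toReal) h2]
  exact lp.sum_rpow_le_norm_rpow (by norm_num) x _

/-- The operator on `ℓ²` which permutes and restricts coordinates along a partial injection. -/
noncomputable def reindex (f : ℕ → Option ℕ) (hf : ∀ s t u, f s = some u → f t = some u → s = t)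
    (x : lp (fun _ : ℕ => ℝ) 2) : lp (fun _ : ℕ => ℝ) 2 :=
  ⟨fun t => (f t).elim 0 x, memℓp_gen' (sum_reindex_le f hf x)⟩

theorem reindex_apply (f : ℕ → Option ℕ) (hf) (x : lp (fun _ : ℕ => ℝ) 2) (t : ℕ) :
    reindex f hf x t = (f t).elim 0 x := rfl

theorem norm_reindex_le (f : ℕ → Option ℕ) (hf) (x : lp (fun _ : ℕ => ℝ) 2) :
    ‖reindex f hf x‖ ≤ ‖x‖ :=
  lp.norm_le_of_forall_sum_le (by norm_num) (norm_nonneg x) (sum_reindex_le f hf x)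

theorem reindex_sub (f : ℕ → Option ℕ) (hf) (x y : lp (fun _ : ℕ => ℝ) 2) :
    reindex f hf (x - y) = reindex f hf x - reindex f hf y := by
  ext t
  simp only [reindex_apply, lp.coeFn_sub, Pi.sub_apply]
  cases f t <;> simp

theorem lipschitzWith_reindex (f : ℕ → Option ℕ) (hf) : LipschitzWith 1 (reindex f hf) :=
  LipschitzWith.of_dist_le_mul fun x y => by
    simpa [dist_eq_norm, reindex_sub] using norm_reindex_le f hf (x - y)

/-- The rational coordinates of a point of Erdős space. -/
noncomputable def coord (x : ErdosSpace) (t : ℕ) : ℚ := (x.2 t).choose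

theorem coe_coord (x : ErdosSpace) (t : ℕ) : (coord x t : ℝ) = x.1 t := (x.2 t).choose_spec.symm

theorem continuous_coord (t : ℕ) : Continuous fun x : ErdosSpace => coord x t := by
  rw [Rat.isEmbedding_coe_real.continuous_iff]
  simp only [Function.comp_def, coe_coord]
  exact (lp.lipschitzWith_one_eval 2 t).continuous.comp continuous_subtype_val

theorem ext_coord {x y : ErdosSpace} (h : ∀ t, coord x t = coord y t) : x = y := by
  refine Subtype.ext (lp.ext (funext fun t => ?_))
  have := congrArg (Rat.cast : ℚ → ℝ) (h t)
  rwa [coe_coord, coe_coord] at this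

theorem abs_coord_le (x : ErdosSpace) (t : ℕ) : |(coord x t : ℝ)| ≤ ‖x.1‖ := by
  rw [coe_coord]
  exact lp.norm_apply_le_norm (by norm_num) x.1 t

/-- The origin of Erdős space. -/
noncomputable def origin : ErdosSpace := ⟨0, fun _ => ⟨0, by simp⟩⟩

theorem dist_origin (x : ErdosSpace) : dist x origin = ‖x.1‖ := by
  rw [Subtype.dist_eq, origin, dist_zero_right]

theorem shift_injective (k : ℕ) :
    ∀ s t u, some (s + k) = some u → some (t + k) = some u → s = t := by
  intro s t u hs ht
  simp only [Option.some.injEq] at hs ht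
  omega

/-- The norm of the sequence obtained by forgetting the first `k` coordinates. -/
noncomputable def tailNorm (k : ℕ) (x : ErdosSpace) : ℝ :=
  ‖reindex (fun t => some (t + k)) (shift_injective k) x.1‖

theorem tailNorm_le_norm (k : ℕ) (x : ErdosSpace) : tailNorm k x ≤ ‖x.1‖ := norm_reindex_le _ _ _

theorem tailNorm_le_add_dist (k : ℕ) (x y : ErdosSpace) :
    tailNorm k x ≤ tailNorm k y + dist x y := by
  have h := (lipschitzWith_reindex (fun t => some (t + k)) (shift_injective k)).dist_le_mul x.1 y.1
  rw [dist_eq_norm, NNReal.coe_one, one_mul] at h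
  have := norm_le_norm_add_norm_sub (reindex (fun t => some (t + k)) (shift_injective k) y.1)
    (reindex (fun t => some (t + k)) (shift_injective k) x.1)
  rw [norm_sub_rev] at this
  exact this.trans (add_le_add le_rfl h)

theorem tendsto_tailNorm (x : ErdosSpace) : Tendsto (fun k => tailNorm k x) atTop (𝓝 0) := by
  have h : ∀ k, tailNorm k x = (∑' t, ‖x.1 (t + k)‖ ^ (2 : ℝ)) ^ (1 / (2 : ℝ)) := by
    intro k
    rw [tailNorm, lp.norm_eq_tsum_rpow (by norm_num)]
    simp [reindex_apply]
  simp only [h]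
  have h0 := (tendsto_sum_nat_add fun t => ‖x.1 t‖ ^ (2 : ℝ)).rpow_const (p := 1 / (2 : ℝ))
    (Or.inr (by norm_num))
  rwa [Real.zero_rpow (by norm_num)] at h0

/-- The partial injection placing the `j`-th of `n` interleaved subsequences after the first `k`
coordinates. -/
def spread (n k : ℕ) [NeZero n] (j : Fin n) (t : ℕ) : Option ℕ :=
  if t < k then none else some ((Nat.divModEquiv n).symm (t - k, j))

theorem spread_injective (n k : ℕ) [NeZero n] (j : Fin n) :
    ∀ s t u, spread n k j s = some u → spread n k j t = some u → s = t := by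
  intro s t u hs ht
  unfold spread at hs ht
  split_ifs at hs ht
  have := hs.trans ht.symm
  simp only [Option.some.injEq, EmbeddingLike.apply_eq_iff_eq, Prod.mk.injEq, and_true] at this
  omega

/-- The partial injection which is inverse to `spread`. -/
def gather (n k : ℕ) [NeZero n] (j : Fin n) (s : ℕ) : Option ℕ :=
  if (Nat.divModEquiv n s).2 = j then some ((Nat.divModEquiv n s).1 + k) else none

theorem gather_injective (n k : ℕ) [NeZero n] (j : Fin n) :
    ∀ s t u, gather n k j s = some u → gather n k j t = some u → s = t := by
  intro s t u hs ht
  unfold gather at hs ht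
  split_ifs at hs ht with h1 h2
  have := hs.trans ht.symm
  simp only [Option.some.injEq, add_left_inj] at this
  exact (Nat.divModEquiv n).injective (Prod.ext this (h1.trans h2.symm))

variable {n k : ℕ} [NeZero n]

theorem assemble_aux_apply (d : Fin k → ℚ) (e : ErdosSpace) (j : Fin n) (t : ℕ) :
    (∑ i : Fin k, lp.single 2 (i : ℕ) (d i : ℝ) + reindex (spread n k j) (spread_injective n k j) e.1 :
      lp (fun _ : ℕ => ℝ) 2) t =
    ((if h : t < k then d ⟨t, h⟩ else coord e ((Nat.divModEquiv n).symm (t - k, j)) : ℚ) : ℝ) := by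
  rw [lp.coeFn_add, Pi.add_apply, lp.coeFn_sum, Finset.sum_apply, reindex_apply, spread]
  split_ifs with h
  · rw [Finset.sum_eq_single ⟨t, h⟩]
    · simp
    · intro b _ hb
      exact lp.single_apply_ne _ _ _ fun h' => hb (Fin.ext h'.symm)
    · simp
  · rw [Finset.sum_eq_zero, zero_add, Option.elim_some, coe_coord]
    intro b _
    exact lp.single_apply_ne _ _ _ fun h' => h (h' ▸ b.2)

/-- The point with given first `k` coordinates, followed by the `j`-th of the `n` interleaved
subsequences of `e`. -/
noncomputable def assemble (d : Fin k → ℚ) (e : ErdosSpace) (j : Fin n) : ErdosSpace :=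
  ⟨∑ i : Fin k, lp.single 2 (i : ℕ) (d i : ℝ) + reindex (spread n k j) (spread_injective n k j) e.1,
    fun t => ⟨_, assemble_aux_apply d e j t⟩⟩

theorem coord_assemble (d : Fin k → ℚ) (e : ErdosSpace) (j : Fin n) (t : ℕ) :
    coord (assemble d e j) t =
      if h : t < k then d ⟨t, h⟩ else coord e ((Nat.divModEquiv n).symm (t - k, j)) := by
  have := assemble_aux_apply d e j t
  rw [← Rat.cast_inj (α := ℝ), coe_coord, ← this]
  rfl

theorem dist_assemble_le (d d' : Fin k → ℚ) (e e' : ErdosSpace) (j : Fin n) :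
    dist (assemble d e j) (assemble d' e' j) ≤ ∑ i, |(d i : ℝ) - d' i| + dist e e' := by
  rw [Subtype.dist_eq]
  refine (dist_add_add_le _ _ _ _).trans (add_le_add ?_ ?_)
  · refine (dist_sum_sum_le _ _ _).trans (Finset.sum_le_sum fun i _ => ?_)
    rw [(lp.isometry_single (E := fun _ : ℕ => ℝ) (p := 2) (i : ℕ)).dist_eq, Real.dist_eq]
  · have h := (lipschitzWith_reindex _ (spread_injective n k j)).dist_le_mul e.1 e'.1
    rwa [NNReal.coe_one, one_mul] at h

theorem scatter_aux_apply (k : ℕ) (x : Fin n → ErdosSpace) (s : ℕ) :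
    (∑ j, reindex (gather n k j) (gather_injective n k j) (x j).1 : lp (fun _ : ℕ => ℝ) 2) s =
      (coord (x (Nat.divModEquiv n s).2) ((Nat.divModEquiv n s).1 + k) : ℝ) := by
  rw [lp.coeFn_sum, Finset.sum_apply, Finset.sum_eq_single (Nat.divModEquiv n s).2]
  · rw [reindex_apply, gather, if_pos rfl, Option.elim_some, coe_coord]
  · intro b _ hb
    rw [reindex_apply, gather, if_neg hb.symm, Option.elim_none]
  · simp

/-- The sequence which interleaves the tails, starting from index `k`, of `n` points. -/
noncomputable def interleave (k : ℕ) (x : Fin n → ErdosSpace) : ErdosSpace :=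
  ⟨∑ j, reindex (gather n k j) (gather_injective n k j) (x j).1,
    fun s => ⟨_, scatter_aux_apply k x s⟩⟩

theorem coord_interleave (k : ℕ) (x : Fin n → ErdosSpace) (s : ℕ) :
    coord (interleave k x) s = coord (x (Nat.divModEquiv n s).2) ((Nat.divModEquiv n s).1 + k) := by
  have := scatter_aux_apply k x s
  rw [← Rat.cast_inj (α := ℝ), coe_coord, ← this]
  rfl

theorem continuous_interleave (k : ℕ) : Continuous (interleave k : (Fin n → ErdosSpace) → _) :=
  Continuous.subtype_mk (continuous_finsetSum _ fun j _ =>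
    (lipschitzWith_reindex _ _).continuous.comp (continuous_subtype_val.comp (continuous_apply j))) _

theorem norm_interleave_le (k : ℕ) (x : Fin n → ErdosSpace) :
    ‖(interleave k x).1‖ ≤ ∑ j, tailNorm k (x j) := by
  refine (norm_sum_le (E := lp (fun _ : ℕ => ℝ) 2) _ _).trans (Finset.sum_le_sum fun j _ => ?_)
  have hg : ∀ s t u, (gather n 0 j) s = some u → (gather n 0 j) t = some u → s = t :=
    gather_injective n 0 j
  have : reindex (gather n k j) (gather_injective n k j) (x j).1 =
      reindex (gather n 0 j) hg (reindex (fun t => some (t + k)) (shift_injective k) (x j).1) := by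
    ext s
    simp only [reindex_apply, gather]
    split_ifs <;> simp [reindex_apply]
  rw [this]
  exact norm_reindex_le _ _ _

theorem continuous_assemble :
    Continuous fun p : (Fin n → Fin k → ℚ) × ErdosSpace => fun j => assemble (p.1 j) p.2 j := by
  refine continuous_pi fun j => Continuous.subtype_mk ?_ _
  refine Continuous.add ?_ ?_
  · refine continuous_finsetSum _ fun i _ => (lp.isometry_single (E := fun _ : ℕ => ℝ) (p := 2) (i : ℕ)).continuous.comp ?_
    exact Rat.continuous_coe_real.comp (by fun_prop)
  · exact (lipschitzWith_reindex _ _).continuous.comp (continuous_subtype_val.comp continuous_snd)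

variable (n k) in
/-- An `n`-tuple of points of Erdős space is determined by the first `k` coordinates of its members
and the interleaving of the remaining tails. -/
noncomputable def assembleHomeomorph :
    (Fin n → Fin k → ℚ) × ErdosSpace ≃ₜ (Fin n → ErdosSpace) where
  toFun p j := assemble (p.1 j) p.2 j
  invFun x := (fun j i => coord (x j) i, interleave k x)
  left_inv p := by
    refine Prod.ext (funext fun j => funext fun i => ?_) (ext_coord fun s => ?_)
    · simp [coord_assemble]
    · simp only [coord_interleave, coord_assemble]
      rw [dif_neg (by simp), Nat.add_sub_cancel, Prod.mk.eta, Equiv.symm_apply_apply]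
  right_inv x := by
    refine funext fun j => ext_coord fun t => ?_
    simp only [coord_assemble, coord_interleave]
    split_ifs with h
    · rfl
    · rw [Equiv.apply_symm_apply, Nat.sub_add_cancel (not_lt.1 h)]
  continuous_toFun := continuous_assemble
  continuous_invFun := by
    refine Continuous.prodMk (continuous_pi fun j => continuous_pi fun i => ?_)
      (continuous_interleave k)
    exact (continuous_coord i).comp (continuous_apply j)

theorem interleave_assemble (d : Fin n → Fin k → ℚ) (e : ErdosSpace) :
    interleave k (fun j => assemble (d j) e j) = e :=
  congrArg Prod.snd ((assembleHomeomorph n k).symm_apply_apply (d, e))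

/-- Erdős space is homeomorphic to its finite powers. -/
noncomputable def powHomeomorph (n : ℕ) [NeZero n] : ErdosSpace ≃ₜ (Fin n → ErdosSpace) :=
  (Homeomorph.uniqueProd (Fin n → Fin 0 → ℚ) ErdosSpace).symm.trans (assembleHomeomorph n 0)

/-- Splitting off the first coordinate. -/
noncomputable def consHomeomorph : ℚ × ErdosSpace ≃ₜ ErdosSpace :=
  (((Homeomorph.funUnique (Fin 1) (Fin 1 → ℚ)).trans
    (Homeomorph.funUnique (Fin 1) ℚ)).symm.prodCongr (Homeomorph.refl ErdosSpace)).trans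
    ((assembleHomeomorph 1 1).trans (Homeomorph.funUnique (Fin 1) ErdosSpace))

theorem consHomeomorph_apply (r : ℚ) (e : ErdosSpace) :
    consHomeomorph (r, e) = assemble (n := 1) (fun _ : Fin 1 => r) e 0 := rfl

theorem abs_le_norm_consHomeomorph (r : ℚ) (e : ErdosSpace) :
    |(r : ℝ)| ≤ ‖(consHomeomorph (r, e)).1‖ := by
  have := abs_coord_le (consHomeomorph (r, e)) 0
  rwa [consHomeomorph_apply, coord_assemble, dif_pos one_pos] at this

theorem norm_le_norm_consHomeomorph (r : ℚ) (e : ErdosSpace) :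
    ‖e.1‖ ≤ ‖(consHomeomorph (r, e)).1‖ := by
  rw [consHomeomorph_apply]
  have h := interleave_assemble (n := 1) (fun _ _ : Fin 1 => r) e
  have h' := norm_interleave_le 1 fun j => assemble (n := 1) (fun _ : Fin 1 => r) e j
  rw [h] at h'
  simpa using h'.trans (Finset.sum_le_sum fun j _ => tailNorm_le_norm 1 _)

theorem norm_consHomeomorph_le (r : ℚ) (e : ErdosSpace) :
    ‖(consHomeomorph (r, e)).1‖ ≤ |(r : ℝ)| + ‖e.1‖ := by
  have h := dist_assemble_le (n := 1) (fun _ : Fin 1 => r) (fun _ => 0) e origin 0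
  have h0 : assemble (n := 1) (fun _ : Fin 1 => 0) origin 0 = origin := by
    refine ext_coord fun t => ?_
    have h0 : ∀ t, coord origin t = 0 := fun t => by
      rw [← Rat.cast_inj (α := ℝ), coe_coord]
      simp [origin]
    rw [coord_assemble]
    split_ifs <;> simp [h0]
  rw [h0, dist_origin, dist_origin] at h
  rw [consHomeomorph_apply]
  simpa using h

end ErdosSpace

/-- Infinite sets indexed by a countable type have an injective choice function. -/
theorem exists_injective_forall_mem_of_infinite {ι β : Type*} [Countable ι] (S : ι → Set β)
    (hS : ∀ i, (S i).Infinite) : ∃ f : ι → β, Function.Injective f ∧ ∀ i, f i ∈ S i := by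
  classical
  cases isEmpty_or_nonempty ι
  · exact ⟨isEmptyElim, Function.injective_of_subsingleton _, isEmptyElim⟩
  obtain ⟨e, he⟩ := exists_surjective_nat ι
  choose t ht hcard using fun m : ℕ => (hS (e m)).exists_subset_card_eq (m + 1)
  obtain ⟨f, hf, hft⟩ := (Finset.all_card_le_biUnion_card_iff_exists_injective t).1 fun s => by
    rcases s.eq_empty_or_nonempty with rfl | hs
    · simp
    · calc s.card ≤ (Finset.range (s.max' hs + 1)).card :=
            Finset.card_le_card fun a ha => Finset.mem_range.2 (Nat.lt_succ_of_le (s.le_max' a ha))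
        _ = (t (s.max' hs)).card := by rw [Finset.card_range, hcard]
        _ ≤ _ := Finset.card_le_card (Finset.subset_biUnion_of_mem t (s.max'_mem hs))
  refine ⟨fun i => f (Function.surjInv he i), hf.comp (Function.injective_surjInv he), fun i => ?_⟩
  have := ht _ (hft (Function.surjInv he i))
  rwa [Function.surjInv_eq he i] at this

theorem neBot_nhdsNE_of_injective {X Y : Type*} [TopologicalSpace X] [TopologicalSpace Y]
    {f : X → Y} (hf : Continuous f) (hinj : Function.Injective f) (x : X) [(𝓝[≠] x).NeBot] :
    (𝓝[≠] (f x)).NeBot :=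
  Tendsto.neBot (f := f) (x := 𝓝[≠] x) <| tendsto_nhdsWithin_iff.2
    ⟨hf.continuousAt.tendsto.mono_left nhdsWithin_le_nhds,
      eventually_nhdsWithin_of_forall fun _ hy => hinj.ne hy⟩

theorem neBot_nhdsNE_subtype {X : Type*} [TopologicalSpace X] {U : Set X} (hU : IsOpen U) (x : U)
    [(𝓝[≠] x.1).NeBot] : (𝓝[≠] x).NeBot := by
  rw [neBot_iff, Ne, ← isOpen_singleton_iff_punctured_nhds]
  intro h
  refine not_isOpen_singleton x.1 ?_
  simpa using hU.isOpenEmbedding_subtypeVal.isOpenMap _ h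

theorem tendsto_comap_of_dist_le {A S : Type*} [PseudoMetricSpace A] {F P : S → A × ℝ} {C : ℝ}
    (h : ∀ s, dist (P s) (F s) ≤ C * (P s).2) (a : A) :
    Tendsto F (comap P (𝓝 (a, 0))) (𝓝 (a, 0)) := by
  have hP : Tendsto P (comap P (𝓝 (a, 0))) (𝓝 (a, 0)) := tendsto_comap
  refine hP.congr_dist (squeeze_zero (fun _ => dist_nonneg) h ?_)
  simpa using (hP.snd_nhds).const_mul C

/-- The layer of the rational line consisting of the points whose absolute value lies between
consecutive multiples of `c`. -/
def ratLayer (c : ℝ) (l : ℕ) : Set ℚ := {r | l * c ≤ |(r : ℝ)| ∧ |(r : ℝ)| < (l + 1) * c}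

theorem isClopen_ratLayer {c : ℝ} (hc : Irrational c) (l : ℕ) : IsClopen (ratLayer c l) := by
  have hcont : Continuous fun r : ℚ => |(r : ℝ)| := Rat.continuous_coe_real.abs
  have hne : ∀ (m : ℕ) (r : ℚ), m ≠ 0 → |(r : ℝ)| ≠ m * c := fun m r hm h =>
    (hc.natCast_mul hm).ne_rat |r| (by rw [← h, Rat.cast_abs])
  have h1 : ratLayer c l =
      {r : ℚ | (l : ℝ) * c ≤ |(r : ℝ)|} ∩ {r : ℚ | |(r : ℝ)| ≤ ((l + 1 : ℕ) : ℝ) * c} := by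
    ext r
    refine and_congr Iff.rfl ⟨fun h => by push_cast; exact h.le, fun h => ?_⟩
    have := lt_of_le_of_ne h (hne _ r l.succ_ne_zero)
    simpa using this
  have h2 : IsOpen {r : ℚ | (l : ℝ) * c ≤ |(r : ℝ)|} := by
    rcases eq_or_ne l 0 with rfl | hl
    · simp
    · have : {r : ℚ | (l : ℝ) * c ≤ |(r : ℝ)|} = {r : ℚ | (l : ℝ) * c < |(r : ℝ)|} := by
        ext r
        exact ⟨fun h => lt_of_le_of_ne h (hne l r hl).symm, fun h => LT.lt.le (b := |(r : ℝ)|) h⟩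
      rw [this]
      exact isOpen_lt continuous_const hcont
  refine ⟨?_, h2.inter (isOpen_lt hcont continuous_const)⟩
  rw [h1]
  exact (isClosed_le continuous_const hcont).inter (isClosed_le hcont continuous_const)

theorem nonempty_ratLayer {c : ℝ} (hc : 0 < c) (l : ℕ) : (ratLayer c l).Nonempty := by
  obtain ⟨r, h1, h2⟩ := exists_rat_btwn (show (l : ℝ) * c < (l + 1) * c by nlinarith)
  have : 0 ≤ (r : ℝ) := by nlinarith [mul_nonneg (Nat.cast_nonneg (α := ℝ) l) hc.le]
  exact ⟨r, by rw [ratLayer, Set.mem_ofPred_eq, abs_of_nonneg this]; exact ⟨h1.le, h2⟩⟩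

theorem exists_mem_ratLayer {c : ℝ} (hc : 0 < c) (r : ℚ) : ∃ l, r ∈ ratLayer c l :=
  ⟨⌊|(r : ℝ)| / c⌋₊, (le_div_iff₀ hc).1 (Nat.floor_le (by positivity)),
    (div_lt_iff₀ hc).1 (Nat.lt_floor_add_one _)⟩

theorem eq_of_mem_ratLayer {c : ℝ} (hc : 0 < c) {r : ℚ} {l l' : ℕ} (h : r ∈ ratLayer c l)
    (h' : r ∈ ratLayer c l') : l = l' := by
  have key : ∀ {a b : ℕ}, r ∈ ratLayer c a → r ∈ ratLayer c b → a ≤ b := fun {a b} ha hb => by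
    have : (a : ℝ) < (b + 1 : ℕ) := by
      push_cast
      exact lt_of_mul_lt_mul_right (ha.1.trans_lt hb.2) hc.le
    exact Nat.lt_succ_iff.1 (Nat.cast_lt.1 this)
  exact le_antisymm (key h h') (key h' h)

theorem nonempty_homeomorph_rat_prod_ratLayer {c : ℝ} (hpos : 0 < c) (l : ℕ) :
    Nonempty (ℚ ≃ₜ ℚ × ratLayer c l) := by
  have : Nonempty (ratLayer c l) := (nonempty_ratLayer hpos l).to_subtype
  obtain ⟨f⟩ := nonempty_homeomorph_rat (X := ℚ × ratLayer c l) fun x =>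
    neBot_nhdsNE_of_injective (f := fun q : ℚ => (q, x.2)) (by fun_prop)
      (fun a b h => (Prod.ext_iff.1 h).1) x.1
  exact ⟨f.symm⟩

open ErdosSpace in
/-- A copy of `ℚ × ErdosSpace` splits into countably many clopen copies of itself, the `l`-th of
which lies at distance about `l * δ`. -/
theorem exists_splitting {δ : ℝ} (hδ : 0 < δ) :
    ∃ ψ : ℕ × (ℚ × ErdosSpace) ≃ ℚ × ErdosSpace, (∀ l, IsOpenEmbedding fun p => ψ (l, p)) ∧
      ∀ l p, δ * (1 + l) + ‖p.2.1‖ ≤ 3 * (δ + ‖(ψ (l, p)).2.1‖) ∧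
        δ + ‖(ψ (l, p)).2.1‖ ≤ 3 * (δ * (1 + l) + ‖p.2.1‖) := by
  obtain ⟨c, hc, hδc, hcδ⟩ := exists_irrational_btwn (show δ < 2 * δ by linarith)
  have hpos : 0 < c := hδ.trans hδc
  let φ := fun l => (nonempty_homeomorph_rat_prod_ratLayer hpos l).some
  let f : ℕ × (ℚ × ErdosSpace) → ℚ × ErdosSpace := fun z =>
    ((φ z.1 z.2.1).1, consHomeomorph ((φ z.1 z.2.1).2, z.2.2))
  have hf : Function.Bijective f := by
    constructor
    · rintro ⟨l, q, e⟩ ⟨l', q', e'⟩ h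
      simp only [f, Prod.mk.injEq, EmbeddingLike.apply_eq_iff_eq] at h
      obtain ⟨h1, h2, rfl⟩ := h
      obtain rfl := eq_of_mem_ratLayer hpos (φ l q).2.2 (h2 ▸ (φ l' q').2.2)
      rw [(φ l).injective (Prod.ext h1 (Subtype.ext h2))]
    · rintro ⟨q, y⟩
      obtain ⟨⟨r, e⟩, rfl⟩ := consHomeomorph.surjective y
      obtain ⟨l, hl⟩ := exists_mem_ratLayer hpos r
      exact ⟨(l, (φ l).symm (q, ⟨r, hl⟩), e), by simp [f]⟩
  refine ⟨Equiv.ofBijective f hf, fun l => ?_, fun l p => ?_⟩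
  · have h1 : IsOpenEmbedding (Prod.map (id : ℚ → ℚ)
        (consHomeomorph ∘ Prod.map (Subtype.val : ratLayer c l → ℚ) (id : ErdosSpace → _))) :=
      IsOpenEmbedding.id.prodMap (consHomeomorph.isOpenEmbedding.comp
        ((isClopen_ratLayer hc l).isOpen.isOpenEmbedding_subtypeVal.prodMap .id))
    exact h1.comp (((φ l).prodCongr (.refl _)).trans (.prodAssoc _ _ _)).isOpenEmbedding
  · obtain ⟨hr1, hr2⟩ := (φ l p.1).2.2
    have h1 := abs_le_norm_consHomeomorph (φ l p.1).2 p.2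
    have h2 := norm_le_norm_consHomeomorph (φ l p.1).2 p.2
    have h3 := norm_consHomeomorph_le (φ l p.1).2 p.2
    have h0 := norm_nonneg p.2.1
    have hl : (0 : ℝ) ≤ l := Nat.cast_nonneg l
    simp only [Equiv.ofBijective_apply, f]
    constructor <;> nlinarith [mul_nonneg hl hδ.le, mul_le_mul_of_nonneg_left hδc.le hl,
      mul_le_mul_of_nonneg_left hcδ.le hl]

/-- The height function on `A ⊕ I × (ℚ × ErdosSpace)`, recording the position over `A` and the
distance to `A`. -/
noncomputable def collarHeight {A I : Type*} (base : I → A) (width : I → ℝ) :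
    A ⊕ I × (ℚ × ErdosSpace) → A × ℝ :=
  Sum.elim (fun a => (a, 0)) fun z => (base z.1, width z.1 + ‖z.2.2.1‖)

/-- A decomposition of `X` into a closed copy of `A` and open copies of `ℚ × ErdosSpace` which
accumulate at every point of `A`, the `i`-th piece lying at distance `width i` from `base i`. -/
structure Collar (A X I : Type*) [TopologicalSpace A] [TopologicalSpace X] where
  /-- The decomposition as a bijection. -/
  toEquiv : A ⊕ I × (ℚ × ErdosSpace) ≃ X
  /-- The point of `A` near which a piece lies. -/
  base : I → A
  /-- The distance of a piece to `A`. -/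
  width : I → ℝ
  width_pos : ∀ i, 0 < width i
  isOpenEmbedding : ∀ i, IsOpenEmbedding fun p => toEquiv (.inr (i, p))
  comap_nhds : ∀ a, comap toEquiv (𝓝 (toEquiv (.inl a))) =
    comap (collarHeight base width) (𝓝 (a, 0))
  exists_base_mem : ∀ a, ∀ U ∈ 𝓝 a, ∀ ε > 0, ∃ i, base i ∈ U ∧ width i < ε

namespace Collar

variable {A X Y I J : Type*} [TopologicalSpace X] [TopologicalSpace Y]

section

variable [MetricSpace A]

theorem continuous_of_dist_le (C : Collar A X I) (D : Collar A Y J) (σ : I → J)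
    (h : ∀ i, dist (C.base i) (D.base (σ i)) ≤ 2 * C.width i ∧ D.width (σ i) ≤ 2 * C.width i) :
    Continuous fun x => D.toEquiv (Sum.map id (Prod.map σ id) (C.toEquiv.symm x)) := by
  rw [continuous_iff_continuousAt]
  intro x
  obtain ⟨s | ⟨i, p⟩, rfl⟩ := C.toEquiv.surjective x
  · have h1 : Tendsto (fun z => collarHeight D.base D.width (Sum.map id (Prod.map σ id) z))
        (comap (collarHeight C.base C.width) (𝓝 (s, 0))) (𝓝 (s, 0)) := by
      refine tendsto_comap_of_dist_le (C := 2) (fun z => ?_) s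
      rcases z with a | ⟨i, p⟩
      · simp [collarHeight]
      · have h0 := norm_nonneg p.2.1
        have h2 := C.width_pos i
        have h3 := D.width_pos (σ i)
        refine max_le ((h i).1.trans ?_) ?_
        · simp only [collarHeight, Sum.elim_inr]
          linarith
        · simp only [collarHeight, Sum.elim_inr, Sum.map_inr, Prod.map, id, Real.dist_eq]
          rw [abs_le]
          constructor <;> linarith [(h i).2]
    have h2 : Tendsto (Sum.map id (Prod.map σ id))
        (comap (collarHeight C.base C.width) (𝓝 (s, 0)))
        (comap (collarHeight D.base D.width) (𝓝 (s, 0))) := tendsto_comap_iff.2 h1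
    rw [← C.comap_nhds, ← D.comap_nhds, tendsto_comap_iff] at h2
    rw [ContinuousAt, Equiv.symm_apply_apply, Sum.map_inl, id]
    have h3 : Tendsto C.toEquiv.symm (𝓝 (C.toEquiv (.inl s)))
        (comap C.toEquiv (𝓝 (C.toEquiv (.inl s)))) := by
      rw [tendsto_comap_iff, Equiv.self_comp_symm]
      exact tendsto_id
    exact h2.comp h3
  · rw [← (C.isOpenEmbedding i).continuousAt_iff]
    simpa [Function.comp_def] using (D.isOpenEmbedding (σ i)).continuous.continuousAt

/-- A collar in which every scale is realised by infinitely many pieces near every point. -/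
def IsRich (C : Collar A X I) : Prop :=
  ∀ (a : A) (δ : ℝ), 0 < δ →
    {i | dist (C.base i) a ≤ δ ∧ δ / 2 ≤ C.width i ∧ C.width i ≤ δ}.Infinite

theorem nonempty_homeomorph_of_isRich [Countable I] [Countable J] {C : Collar A X I}
    {D : Collar A Y J} (hC : C.IsRich) (hD : D.IsRich) : Nonempty (X ≃ₜ Y) := by
  let R : I → J → Prop := fun i j =>
    (dist (C.base i) (D.base j) ≤ 2 * C.width i ∧ D.width j ≤ 2 * C.width i) ∧
    (dist (D.base j) (C.base i) ≤ 2 * D.width j ∧ C.width i ≤ 2 * D.width j)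
  obtain ⟨f, hf, hfR⟩ := exists_injective_forall_mem_of_infinite _
    fun i => hD (C.base i) (C.width i) (C.width_pos i)
  obtain ⟨g, hg, hgR⟩ := exists_injective_forall_mem_of_infinite _
    fun j => hC (D.base j) (D.width j) (D.width_pos j)
  obtain ⟨σ, hσ, hR⟩ := Function.Embedding.schroeder_bernstein_of_rel hf hg R
    (fun i => by
      obtain ⟨h1, h2, h3⟩ := hfR i
      have := dist_comm (C.base i) (D.base (f i))
      have := C.width_pos i
      refine ⟨⟨?_, ?_⟩, ?_, ?_⟩ <;> linarith)
    (fun j => by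
      obtain ⟨h1, h2, h3⟩ := hgR j
      have := dist_comm (C.base (g j)) (D.base j)
      have := D.width_pos j
      refine ⟨⟨?_, ?_⟩, ?_, ?_⟩ <;> linarith)
  let τ := Equiv.ofBijective σ hσ
  refine ⟨⟨(C.toEquiv.symm.trans (Equiv.sumCongr (.refl A) (τ.prodCongr (.refl _)))).trans D.toEquiv,
    C.continuous_of_dist_le D σ fun i => (hR i).1,
    D.continuous_of_dist_le C τ.symm fun j => ?_⟩⟩
  have := (hR (τ.symm j)).2
  rwa [show σ (τ.symm j) = j from τ.apply_symm_apply j] at this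

theorem exists_isRich (C : Collar A X I) : ∃ D : Collar A X (I × ℕ), D.IsRich := by
  choose ψ hψ hle using fun i => exists_splitting (C.width_pos i)
  let width : I × ℕ → ℝ := fun i => C.width i.1 * (1 + i.2)
  have hwidth : ∀ i, 0 < width i := fun i => mul_pos (C.width_pos i.1) (by positivity)
  let T : A ⊕ (I × ℕ) × (ℚ × ErdosSpace) ≃ A ⊕ I × (ℚ × ErdosSpace) :=
    Equiv.sumCongr (.refl A) ((Equiv.prodAssoc I ℕ _).trans (Equiv.prodCongrRight ψ))
  have hdist : ∀ a b : ℝ, 0 < a → 0 < b → a ≤ 3 * b → b ≤ 3 * a → |b - a| ≤ 3 * min b a := by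
    intro a b ha hb h1 h2
    rw [abs_le]
    rcases min_choice b a with h | h <;> rw [h] <;> constructor <;> linarith
  have key : ∀ z, dist (collarHeight C.base C.width (T z))
      (collarHeight (fun i : I × ℕ => C.base i.1) width z) ≤
        3 * min (collarHeight C.base C.width (T z)).2
          (collarHeight (fun i : I × ℕ => C.base i.1) width z).2 := by
    rintro (a | ⟨⟨i, l⟩, p⟩)
    · simp [T, collarHeight]
    · have h := hle i l p
      have h1 := C.width_pos i
      have h2 := hwidth (i, l)
      have h3 := norm_nonneg p.2.1
      have h4 := norm_nonneg (ψ i (l, p)).2.1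
      have h5 := hdist _ _ (add_pos_of_pos_of_nonneg h2 h3) (add_pos_of_pos_of_nonneg h1 h4) h.1 h.2
      refine max_le ((dist_self (C.base i)).trans_le ?_) h5
      exact (abs_nonneg _).trans h5
  refine ⟨⟨T.trans C.toEquiv, fun i => C.base i.1, width, hwidth, fun i => ?_, fun a => ?_,
    fun a U hU ε hε => ?_⟩, fun a δ hδ => ?_⟩
  · exact (C.isOpenEmbedding i.1).comp (hψ i.1 i.2)
  · rw [Equiv.coe_trans, ← comap_comap]
    refine (congrArg (comap T) (C.comap_nhds a)).trans ?_
    rw [comap_comap]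
    refine le_antisymm ?_ ?_
    · rw [← tendsto_iff_comap]
      exact tendsto_comap_of_dist_le (C := 3) (fun z => (key z).trans (by gcongr; exact min_le_left _ _)) a
    · rw [← tendsto_iff_comap]
      refine tendsto_comap_of_dist_le (C := 3) (fun z => ?_) a
      rw [dist_comm]
      exact (key z).trans (by gcongr; exact min_le_right _ _)
  · obtain ⟨i, hi, hlt⟩ := C.exists_base_mem a U hU ε hε
    exact ⟨(i, 0), hi, by simpa [width] using hlt⟩
  · have hinf : {i | dist (C.base i) a < δ ∧ C.width i < δ / 2}.Infinite := by
      intro hfin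
      have h1 : ∀ᶠ ε in 𝓝[>] (0 : ℝ), ∀ i ∈ {i | dist (C.base i) a < δ ∧ C.width i < δ / 2},
          ε < C.width i := (eventually_all_finite hfin).2 fun i _ =>
        nhdsWithin_le_nhds (Iio_mem_nhds (C.width_pos i))
      obtain ⟨ε, hε, hpos⟩ := (h1.and self_mem_nhdsWithin).exists
      obtain ⟨i, hi, hlt⟩ := C.exists_base_mem a _ (Metric.ball_mem_nhds a hδ) (min ε (δ / 2))
        (lt_min hpos (half_pos hδ))
      exact absurd (hε i ⟨hi, hlt.trans_le (min_le_right _ _)⟩) (hlt.trans_le (min_le_left _ _)).not_gt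
    refine (hinf.image (f := fun i => (i, ⌊δ / C.width i⌋₊ - 1)) fun i _ j _ h =>
      (Prod.ext_iff.1 h).1).mono ?_
    rintro _ ⟨i, ⟨h1, h2⟩, rfl⟩
    have hw := C.width_pos i
    have h3 : 2 < δ / C.width i := (lt_div_iff₀ hw).2 (by linarith)
    have h4 : 1 ≤ ⌊δ / C.width i⌋₊ := Nat.le_floor (by push_cast; linarith)
    have h5 : width (i, ⌊δ / C.width i⌋₊ - 1) = C.width i * ⌊δ / C.width i⌋₊ := by
      simp only [width]
      rw [Nat.cast_sub h4]
      push_cast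
      ring
    have h6 := Nat.floor_le (show 0 ≤ δ / C.width i by positivity)
    have h7 := Nat.lt_floor_add_one (δ / C.width i)
    have h8 : C.width i * (δ / C.width i) = δ := by field_simp
    refine ⟨h1.le, ?_, ?_⟩
    · show _ ≤ width _
      rw [h5]
      nlinarith
    · show width _ ≤ _
      rw [h5]
      nlinarith

/-- Spaces with collars over the same metric space are homeomorphic. -/
theorem nonempty_homeomorph [Countable I] [Countable J] (C : Collar A X I) (D : Collar A Y J) :
    Nonempty (X ≃ₜ Y) := by
  obtain ⟨C', hC⟩ := C.exists_isRich
  obtain ⟨D', hD⟩ := D.exists_isRich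
  exact nonempty_homeomorph_of_isRich hC hD

end

/-- Transport of a collar along a homeomorphism. -/
def congr {B : Type*} [TopologicalSpace A] [TopologicalSpace B] (C : Collar A X I) (h : A ≃ₜ B) :
    Collar B X I where
  toEquiv := (Equiv.sumCongr h.symm.toEquiv (.refl _)).trans C.toEquiv
  base i := h (C.base i)
  width := C.width
  width_pos := C.width_pos
  isOpenEmbedding := C.isOpenEmbedding
  comap_nhds b := by
    have h1 : collarHeight C.base C.width ∘ Equiv.sumCongr h.symm.toEquiv (.refl _) =
        (h.symm.prodCongr (.refl ℝ)) ∘ collarHeight (fun i => h (C.base i)) C.width := by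
      funext z
      rcases z with a | z <;> simp [collarHeight]
    rw [Equiv.coe_trans, ← comap_comap]
    refine (congrArg (comap _) (C.comap_nhds (h.symm b))).trans ?_
    rw [comap_comap, h1, ← comap_comap]
    congr 1
    exact (h.symm.prodCongr (.refl ℝ)).comap_nhds_eq _ |>.trans (by simp)
  exists_base_mem b U hU ε hε := by
    obtain ⟨i, hi, hlt⟩ := C.exists_base_mem (h.symm b) (h ⁻¹' U)
      (h.continuous.continuousAt.preimage_mem_nhds (by simpa using hU)) ε hε
    exact ⟨i, hi, hlt⟩

end Collar

namespace ErdosSpace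

theorem continuous_floor_of_ne {X : Type*} [TopologicalSpace X] {f : X → ℝ} (hf : Continuous f)
    (hne : ∀ x (z : ℤ), f x ≠ z) : Continuous fun x => ⌊f x⌋ := by
  refine continuous_discrete_rng.2 fun z => ?_
  have : (fun x => ⌊f x⌋) ⁻¹' {z} = {x | (z : ℝ) < f x} ∩ {x | f x < z + 1} := by
    ext x
    simp only [mem_preimage, mem_singleton_iff, Int.floor_eq_iff]
    exact and_congr_left fun _ => ⟨fun h => lt_of_le_of_ne h (hne x z).symm, fun h => le_of_lt h⟩
  rw [this]
  exact (isOpen_lt continuous_const hf).inter (isOpen_lt hf continuous_const)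

/-- The grid cell containing the `t`-th coordinate of `x`, for a grid of mesh `1 / (m + 1) ^ 2`
avoiding the rationals. -/
noncomputable def cell (m : ℕ) (x : ErdosSpace) (t : ℕ) : ℤ :=
  ⌊((coord x t : ℝ) + √2) * ((m + 1) ^ 2 : ℕ)⌋

theorem continuous_cell (m t : ℕ) : Continuous fun x => cell m x t := by
  refine continuous_floor_of_ne (X := ErdosSpace)
    (((Rat.continuous_coe_real.comp (continuous_coord t)).add_const _).mul_const _) fun x z => ?_
  exact ((irrational_sqrt_two.ratCast_add _).mul_natCast (by positivity)).ne_int z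

theorem abs_sub_le_of_cell_eq {m t : ℕ} {x y : ErdosSpace} (h : cell m x t = cell m y t) :
    |(coord x t : ℝ) - coord y t| ≤ 1 / (m + 1) ^ 2 := by
  have h1 := (Int.abs_sub_lt_one_of_floor_eq_floor h).le
  rw [← sub_mul, add_sub_add_right_eq_sub, abs_mul, Nat.abs_cast] at h1
  rw [le_div_iff₀ (by positivity)]
  exact_mod_cast h1

/-- A code for the grid cells of the first `m + 1` coordinates. -/
noncomputable def code (m : ℕ) (x : ErdosSpace) : ℕ :=
  Encodable.encode fun t : Fin (m + 1) => cell m x t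

theorem continuous_code (m : ℕ) : Continuous (code m) :=
  (continuous_of_discreteTopology (f := (Encodable.encode : (Fin (m + 1) → ℤ) → ℕ))).comp
    (continuous_pi fun t => continuous_cell m t)

theorem code_congr {m : ℕ} {x y : ErdosSpace} (h : ∀ t < m + 1, coord x t = coord y t) :
    code m x = code m y :=
  congrArg Encodable.encode <| funext fun t => by rw [cell, cell, h t t.2]

theorem sum_abs_sub_le_of_code_eq {m : ℕ} {x y : ErdosSpace} (h : code m x = code m y) :
    ∑ t : Fin (m + 1), |(coord x t : ℝ) - coord y t| ≤ 1 / (m + 1) := by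
  calc ∑ t : Fin (m + 1), |(coord x t : ℝ) - coord y t| ≤ ∑ t : Fin (m + 1), 1 / ((m : ℝ) + 1) ^ 2 :=
        Finset.sum_le_sum fun t _ =>
          abs_sub_le_of_cell_eq (congrFun (Encodable.encode_injective h) t)
    _ = 1 / (m + 1) := by
        rw [Finset.sum_const, Finset.card_univ, Fintype.card_fin, nsmul_eq_mul]
        field_simp
        push_cast
        ring

theorem eventually_code_ne {x y : ErdosSpace} (h : x ≠ y) :
    ∀ᶠ m in atTop, code m x ≠ code m y := by
  obtain ⟨t, ht⟩ : ∃ t, coord x t ≠ coord y t := by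
    by_contra! h'
    exact h (ext_coord h')
  have hpos : 0 < |(coord x t : ℝ) - coord y t| := by
    rw [abs_pos, sub_ne_zero]
    exact_mod_cast ht
  filter_upwards [tendsto_one_div_add_atTop_nhds_zero_nat.eventually (gt_mem_nhds hpos),
    eventually_ge_atTop t] with m hm htm heq
  have h1 := Finset.single_le_sum (f := fun s : Fin (m + 1) => |(coord x s : ℝ) - coord y s|)
    (fun s _ => abs_nonneg _) (Finset.mem_univ (⟨t, Nat.lt_succ_of_le htm⟩ : Fin (m + 1)))
  exact absurd (h1.trans (sum_abs_sub_le_of_code_eq heq)) hm.not_ge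

variable {n : ℕ}

/-- The tuples whose members are first told apart by their codes of level `m`, the codes then
satisfying the condition `good`. -/
def normalTuples (good : (Fin n → ℕ) → Prop) (m : ℕ) : Set (Fin n → ErdosSpace) :=
  {x | good (code m ∘ x) ∧ ∀ k < m, ¬ Function.Injective (code k ∘ x)}

theorem isClopen_normalTuples (good : (Fin n → ℕ) → Prop) (m : ℕ) :
    IsClopen (normalTuples good m) := by
  have hc : ∀ k, Continuous fun x : Fin n → ErdosSpace => code k ∘ x := fun k =>
    continuous_pi fun j => (continuous_code k).comp (continuous_apply j)
  have h : normalTuples good m = (fun x => code m ∘ x) ⁻¹' {c | good c} ∩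
      ⋂ k ∈ Finset.range m, (fun x => code k ∘ x) ⁻¹' {c | ¬ Function.Injective c} := by
    ext x
    simp [normalTuples]
  rw [h]
  exact ((isClopen_discrete _).preimage (hc m)).inter
    (isClopen_biInter_finset fun k _ => (isClopen_discrete _).preimage (hc k))

theorem mem_normalTuples_congr {good : (Fin n → ℕ) → Prop} {m : ℕ} {x y : Fin n → ErdosSpace}
    (h : ∀ j, ∀ t < m + 1, coord (x j) t = coord (y j) t) :
    x ∈ normalTuples good m ↔ y ∈ normalTuples good m := by
  have h' : ∀ k ≤ m, code k ∘ x = code k ∘ y := fun k hk =>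
    funext fun j => code_congr fun t ht => h j t (by omega)
  rw [normalTuples, mem_ofPred_eq, mem_ofPred_eq, h' m le_rfl]
  exact and_congr_right fun _ => forall₂_congr fun k hk => by rw [h' k hk.le]

/-- The normal tuples with prescribed level and code. -/
def normalCell (good : (Fin n → ℕ) → Prop) (i : ℕ × (Fin n → ℕ)) : Set (Fin n → ErdosSpace) :=
  {x | x ∈ normalTuples good i.1 ∧ code i.1 ∘ x = i.2}

theorem isClopen_normalCell (good : (Fin n → ℕ) → Prop) (i : ℕ × (Fin n → ℕ)) :
    IsClopen (normalCell good i) :=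
  (isClopen_normalTuples good i.1).inter ((isClopen_discrete {i.2}).preimage
    (continuous_pi fun j => (continuous_code i.1).comp (continuous_apply j)))

variable [NeZero n]

theorem coord_assembleHomeomorph_eq {k : ℕ} (d : Fin n → Fin k → ℚ) (e e' : ErdosSpace) (j : Fin n)
    (t : ℕ) (ht : t < k) :
    coord (assembleHomeomorph n k (d, e) j) t = coord (assembleHomeomorph n k (d, e') j) t := by
  change coord (assemble (d j) e j) t = coord (assemble (d j) e' j) t
  simp [coord_assemble, ht]

theorem norm_le_sum_tailNorm_assembleHomeomorph {k : ℕ} (d : Fin n → Fin k → ℚ) (e : ErdosSpace) :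
    ‖e.1‖ ≤ ∑ j, tailNorm k (assembleHomeomorph n k (d, e) j) := by
  have := norm_interleave_le k (assembleHomeomorph n k (d, e))
  rwa [show interleave k (assembleHomeomorph n k (d, e)) = e from interleave_assemble d e] at this

theorem dist_assembleHomeomorph_le_of_code_eq {m : ℕ} {d d' : Fin n → Fin (m + 1) → ℚ}
    {e e' : ErdosSpace} (h : code m ∘ assembleHomeomorph n (m + 1) (d, e) =
      code m ∘ assembleHomeomorph n (m + 1) (d', e')) :
    dist (assembleHomeomorph n (m + 1) (d, e)) (assembleHomeomorph n (m + 1) (d', e')) ≤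
      1 / (m + 1) + dist e e' := by
  refine (dist_pi_le_iff (by positivity)).2 fun j => ?_
  refine (dist_assemble_le (d j) (d' j) e e' j).trans (add_le_add ?_ le_rfl)
  refine le_of_eq_of_le (Finset.sum_congr rfl fun t _ => ?_)
    (sum_abs_sub_le_of_code_eq (congrFun h j))
  change _ = |((coord (assemble (d j) e j) t : ℚ) : ℝ) - (coord (assemble (d' j) e' j) t : ℚ)|
  simp only [coord_assemble, t.2, dif_pos]

theorem mem_normalCell_assemble_iff {good : (Fin n → ℕ) → Prop} {i : ℕ × (Fin n → ℕ)}
    (d : Fin n → Fin (i.1 + 1) → ℚ) (e e' : ErdosSpace) :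
    assembleHomeomorph n (i.1 + 1) (d, e) ∈ normalCell good i ↔
      assembleHomeomorph n (i.1 + 1) (d, e') ∈ normalCell good i := by
  have h := fun j t => coord_assembleHomeomorph_eq d e e' j t
  refine and_congr (mem_normalTuples_congr h) ?_
  rw [show code i.1 ∘ assembleHomeomorph n (i.1 + 1) (d, e) =
    code i.1 ∘ assembleHomeomorph n (i.1 + 1) (d, e') from funext fun j => code_congr (h j)]

instance (k : ℕ) [NeZero k] (d : Fin n → Fin k → ℚ) : (𝓝[≠] d).NeBot := by
  classical
  have h := neBot_nhdsNE_of_injective (f := fun r : ℚ => Function.update d 0 (Function.update (d 0) 0 r))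
    (by fun_prop) ((Function.update_injective d 0).comp (Function.update_injective (d 0) 0)) (d 0 0)
  simpa using h

theorem exists_normalCell_parametrization {good : (Fin n → ℕ) → Prop} {i : ℕ × (Fin n → ℕ)}
    (h : (normalCell good i).Nonempty) :
    ∃ φ : ℚ → (Fin n → Fin (i.1 + 1) → ℚ),
      IsOpenEmbedding (fun p : ℚ × ErdosSpace => assembleHomeomorph n (i.1 + 1) (φ p.1, p.2)) ∧
      range (fun p : ℚ × ErdosSpace => assembleHomeomorph n (i.1 + 1) (φ p.1, p.2)) =
        normalCell good i := by
  let S : Set (Fin n → Fin (i.1 + 1) → ℚ) :=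
    {d | assembleHomeomorph n (i.1 + 1) (d, origin) ∈ normalCell good i}
  have hS : IsOpen S := (isClopen_normalCell good i).isOpen.preimage (by fun_prop)
  have hne : Nonempty S := by
    obtain ⟨x, hx⟩ := h
    obtain ⟨⟨d, e⟩, rfl⟩ := (assembleHomeomorph n (i.1 + 1)).surjective x
    exact ⟨d, (mem_normalCell_assemble_iff d _ _).1 hx⟩
  obtain ⟨φ⟩ := nonempty_homeomorph_rat fun x : S => neBot_nhdsNE_subtype hS x
  refine ⟨fun r => φ.symm r, ?_, ?_⟩
  · exact (assembleHomeomorph n (i.1 + 1)).isOpenEmbedding.comp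
      ((hS.isOpenEmbedding_subtypeVal.comp φ.symm.isOpenEmbedding).prodMap .id)
  · ext x
    constructor
    · rintro ⟨⟨r, e⟩, rfl⟩
      exact (mem_normalCell_assemble_iff _ _ _).1 (φ.symm r).2
    · intro hx
      obtain ⟨⟨d, e⟩, rfl⟩ := (assembleHomeomorph n (i.1 + 1)).surjective x
      refine ⟨(φ ⟨d, (mem_normalCell_assemble_iff d _ _).1 hx⟩, e), ?_⟩
      simp

/-- A metric quotient of the space of tuples of points of Erdős space in which normal tuples
represent precisely the points outside `A`, in a continuous way, has a collar over `A`. -/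
theorem exists_collar {X : Type*} [MetricSpace X] (good : (Fin n → ℕ) → Prop)
    (q : (Fin n → ErdosSpace) → X) (hq : ∀ x y, dist (q x) (q y) ≤ dist x y) {A : Set X}
    (hA : A.Nonempty) (hAc : IsClosed A) (hAd : A ⊆ closure Aᶜ)
    (hnormal : ∀ p, p ∉ A ↔ ∃ m, ∃ x ∈ normalTuples good m, q x = p)
    (hcont : ∀ m, ∀ x ∈ normalTuples good m, ∀ ε > 0, ∃ η > 0, ∀ m', ∀ x' ∈ normalTuples good m',
      dist (q x') (q x) < η → m' = m ∧ code m ∘ x' = code m ∘ x ∧ dist x' x < ε)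
    (hsmall : ∀ a ∈ A, ∀ ε > 0, ∃ η > 0, ∀ m, ∀ x ∈ normalTuples good m,
      dist (q x) a < η → 1 / ((m : ℝ) + 1) < ε ∧ ∀ j, tailNorm (m + 1) (x j) < ε) :
    ∃ I : Type, Countable I ∧ Nonempty (Collar A X I) := by
  let I := {i : ℕ × (Fin n → ℕ) // (normalCell good i).Nonempty}
  refine ⟨I, inferInstance, ?_⟩
  choose φ hφ hrange using fun i : I => exists_normalCell_parametrization i.2
  let f : (i : I) → ℚ × ErdosSpace → (Fin n → ErdosSpace) :=
    fun i p => assembleHomeomorph n (i.1.1 + 1) (φ i p.1, p.2)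
  have hf : ∀ i p, f i p ∈ normalCell good i.1 := fun i p => hrange i ▸ mem_range_self p
  have hqc : Continuous q := (LipschitzWith.of_dist_le_mul (K := 1) fun x y => by
    simpa using hq x y).continuous
  have hqA : ∀ i p, q (f i p) ∉ A := fun i p => (hnormal _).2 ⟨_, _, (hf i p).1, rfl⟩
  have hinj : ∀ i i' p p', q (f i p) = q (f i' p') → i = i' ∧ f i p = f i' p' := by
    intro i i' p p' h
    have h1 : ∀ ε > 0, i.1 = i'.1 ∧ dist (f i p) (f i' p') < ε := by
      intro ε hε
      obtain ⟨η, hη, h1⟩ := hcont _ _ (hf i' p').1 ε hε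
      obtain ⟨h2, h3, h4⟩ := h1 _ _ (hf i p).1 (by rwa [h, dist_self])
      refine ⟨Prod.ext h2 ?_, h4⟩
      rw [← (hf i p).2, ← (hf i' p').2, h2, h3]
    exact ⟨Subtype.ext (h1 1 one_pos).1, eq_of_forall_dist_le fun ε hε => (h1 ε hε).2.le⟩
  let W : A ⊕ I × (ℚ × ErdosSpace) → X := Sum.elim Subtype.val fun z => q (f z.1 z.2)
  have hW : Function.Bijective W := by
    constructor
    · rintro (a | ⟨i, p⟩) (b | ⟨i', p'⟩) h
      · exact congrArg _ (Subtype.ext h)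
      · exact absurd (show q (f i' p') ∈ A from (show a.1 = q (f i' p') from h) ▸ a.2) (hqA i' p')
      · exact absurd (show q (f i p) ∈ A from (show q (f i p) = b.1 from h) ▸ b.2) (hqA i p)
      · obtain ⟨rfl, h'⟩ := hinj i i' p p' h
        rw [(hφ i).injective h']
    · intro p
      by_cases hp : p ∈ A
      · exact ⟨.inl ⟨p, hp⟩, rfl⟩
      · obtain ⟨m, x, hx, rfl⟩ := (hnormal p).1 hp
        have hx' : x ∈ normalCell good (m, code m ∘ x) := ⟨hx, rfl⟩
        rw [← hrange ⟨_, x, hx'⟩] at hx'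
        obtain ⟨p, hp⟩ := hx'
        exact ⟨.inr (_, p), congrArg q hp⟩
  let center : I → X := fun i => q (f i (0, origin))
  let width : I → ℝ := fun i => Metric.infDist (center i) A + 1 / (i.1.1 + 1)
  have hwidth : ∀ i, Metric.infDist (center i) A < width i := fun i =>
    lt_add_of_pos_right _ (by positivity)
  have hbase : ∀ i, ∃ a : A, dist (center i) a < width i := fun i => by
    obtain ⟨a, ha, h⟩ := (Metric.infDist_lt_iff hA).1 (hwidth i)
    exact ⟨⟨a, ha⟩, h⟩
  choose base hbase using hbase
  have hcenter : ∀ i p, dist (q (f i p)) (center i) ≤ 1 / (i.1.1 + 1) + ‖p.2.1‖ := by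
    intro i p
    rw [← dist_origin]
    refine (hq _ _).trans (dist_assembleHomeomorph_le_of_code_eq ?_)
    exact (hf i p).2.trans (hf i (0, origin)).2.symm
  have hlt : ∀ i : I, 1 / ((i.1.1 : ℝ) + 1) ≤ width i := fun i =>
    le_add_of_nonneg_left Metric.infDist_nonneg
  have h1 : ∀ a : A, Tendsto W (comap (collarHeight base width) (𝓝 (a, 0))) (𝓝 a.1) := by
    intro a
    have h2 : Tendsto (collarHeight base width) (comap (collarHeight base width) (𝓝 (a, 0)))
      (𝓝 (a, 0)) := tendsto_comap
    refine (continuous_subtype_val.continuousAt.tendsto.comp h2.fst_nhds).congr_dist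
      (squeeze_zero (g := fun z => 2 * (collarHeight base width z).2) (fun _ => dist_nonneg) ?_ ?_)
    · rintro (b | ⟨i, p⟩)
      · simp [collarHeight, W]
      · have h3 := dist_triangle_left (base i).1 (q (f i p)) (center i)
        have := dist_comm (q (f i p)) (center i)
        have h4 := hcenter i p
        have h5 := hbase i
        have h6 := hlt i
        have h7 := norm_nonneg p.2.1
        change dist (base i).1 (q (f i p)) ≤ 2 * (width i + ‖p.2.1‖)
        linarith
    · simpa using h2.snd_nhds.const_mul 2
  have h2 : ∀ a : A, Tendsto (collarHeight base width) (comap W (𝓝 a.1)) (𝓝 (a, 0)) := by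
    intro a
    refine Metric.tendsto_nhds.2 fun ε' hε' => ?_
    obtain ⟨ε, hε, rfl⟩ : ∃ ε > 0, (2 * (n : ℝ) + 6) * ε = ε' :=
      ⟨ε' / (2 * (n : ℝ) + 6), by positivity, by field_simp⟩
    obtain ⟨η, hη, h⟩ := hsmall a a.2 ε hε
    have hn := mul_nonneg (Nat.cast_nonneg (α := ℝ) n) hε.le
    filter_upwards [preimage_mem_comap (Metric.ball_mem_nhds a.1 (lt_min hη hε))]
    rintro (b | ⟨i, p⟩) hz
    · have hz' : dist b.1 a.1 < ε := hz.trans_le (min_le_right _ _)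
      refine max_lt (show dist b.1 a.1 < _ by linarith) ?_
      simp only [collarHeight, Sum.elim_inl, dist_self]
      linarith
    · have hz1 : dist (q (f i p)) a.1 < η := hz.trans_le (min_le_left _ _)
      have hz2 : dist (q (f i p)) a.1 < ε := hz.trans_le (min_le_right _ _)
      obtain ⟨hm, ht⟩ := h _ _ (hf i p).1 hz1
      have hnorm : ‖p.2.1‖ ≤ n * ε :=
        (norm_le_sum_tailNorm_assembleHomeomorph (φ i p.1) p.2).trans
          ((Finset.sum_le_sum fun j _ => (ht j).le).trans (by simp))
      have h3 := dist_triangle_left (center i) a.1 (q (f i p))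
      have h4 := hcenter i p
      have h5 := hbase i
      have h6 : width i ≤ dist (center i) a.1 + 1 / (i.1.1 + 1) :=
        add_le_add (Metric.infDist_le_dist_of_mem a.2) le_rfl
      have h7 := dist_triangle_left (base i).1 a.1 (center i)
      have h8 := hlt i
      have h9 : (0 : ℝ) < 1 / (i.1.1 + 1) := by positivity
      refine max_lt (show dist (base i).1 a.1 < _ by linarith) ?_
      simp only [collarHeight, Sum.elim_inr, Real.dist_0_eq_abs]
      rw [abs_lt]
      constructor <;> linarith [norm_nonneg p.2.1]
  refine ⟨⟨Equiv.ofBijective W hW, base, width, fun i => Metric.infDist_nonneg.trans_lt (hwidth i),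
    fun i => ?_, fun a => ?_, fun a U hU ε hε => ?_⟩⟩
  · refine .of_continuous_injective_isOpenMap (hqc.comp (hφ i).continuous)
      (fun p p' h => (hφ i).injective (hinj i i p p' h).2) (IsOpenMap.of_nhds_le fun p U hU => ?_)
    have hU' := (hφ i).isOpenMap.image_mem_nhds hU
    obtain ⟨ε, hε, hball⟩ := Metric.mem_nhds_iff.1 hU'
    obtain ⟨η, hη, h⟩ := hcont _ _ (hf i p).1 ε hε
    filter_upwards [Metric.ball_mem_nhds _ hη, hAc.isOpen_compl.mem_nhds (hqA i p)] with y hy hyA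
    obtain ⟨m', x', hx', rfl⟩ := (hnormal y).1 hyA
    obtain ⟨p', hp', rfl⟩ := hball (h m' x' hx' hy).2.2
    exact hp'
  · exact le_antisymm (tendsto_iff_comap.1 (h2 a)) (tendsto_iff_comap.1 (h1 a))
  · obtain ⟨V, hV, hsub⟩ := h2 a (prod_mem_nhds hU (Iio_mem_nhds hε))
    obtain ⟨p, hpV, hpA⟩ := mem_closure_iff_nhds.1 (hAd a.2) V hV
    obtain ⟨b | ⟨i, z⟩, rfl⟩ := hW.surjective p
    · exact absurd b.2 hpA
    · obtain ⟨h3, h4⟩ := hsub hpV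
      exact ⟨i, h3, (le_add_of_nonneg_right (norm_nonneg _)).trans_lt h4⟩

end ErdosSpace

namespace ErdosSpace

instance (x : ErdosSpace) : (𝓝[≠] x).NeBot := by
  obtain ⟨⟨r, e⟩, rfl⟩ := consHomeomorph.surjective x
  exact neBot_nhdsNE_of_injective (f := fun r : ℚ => consHomeomorph (r, e)) (by fun_prop)
    (fun a b h => (Prod.ext_iff.1 (consHomeomorph.injective h)).1) r

variable {n : ℕ} {good : (Fin n → ℕ) → Prop}

theorem exists_injective_dist_lt (x : Fin n → ErdosSpace) {ε : ℝ} (hε : 0 < ε) :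
    ∃ y : Fin n → ErdosSpace, Function.Injective y ∧ dist y x < ε := by
  obtain ⟨y, hy, hd⟩ := exists_injective_forall_mem_of_infinite _
    fun j => infinite_of_mem_nhds (x j) (Metric.ball_mem_nhds (x j) hε)
  exact ⟨y, hy, (dist_pi_lt_iff hε).2 hd⟩

theorem injective_of_mem_normalTuples (hgood : ∀ c, good c → Function.Injective c) {m : ℕ}
    {x : Fin n → ErdosSpace} (hx : x ∈ normalTuples good m) : Function.Injective x :=
  (hgood _ hx.1).of_comp

theorem eq_of_mem_normalTuples (hgood : ∀ c, good c → Function.Injective c) {m m' : ℕ}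
    {x : Fin n → ErdosSpace} (hx : x ∈ normalTuples good m) (hx' : x ∈ normalTuples good m') :
    m = m' :=
  le_antisymm (not_lt.1 fun h => hx.2 _ h (hgood _ hx'.1))
    (not_lt.1 fun h => hx'.2 _ h (hgood _ hx.1))

theorem exists_mem_normalTuples_injective {x : Fin n → ErdosSpace} (hx : Function.Injective x) :
    ∃ m, x ∈ normalTuples Function.Injective m := by
  classical
  have h : ∃ m, Function.Injective (code m ∘ x) := by
    have : ∀ᶠ m in atTop, ∀ i j, i ≠ j → code m (x i) ≠ code m (x j) := by
      simp only [eventually_all]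
      exact fun i j hij => eventually_code_ne (hx.ne hij)
    obtain ⟨m, hm⟩ := this.exists
    exact ⟨m, fun i j hij => by_contra fun hne => hm i j hne hij⟩
  exact ⟨Nat.find h, Nat.find_spec h, fun k hk => Nat.find_min h hk⟩

theorem exists_mem_normalTuples_strictMono {x : Fin n → ErdosSpace} (hx : Function.Injective x) :
    ∃ m, ∃ σ : Equiv.Perm (Fin n), x ∘ σ ∈ normalTuples StrictMono m := by
  obtain ⟨m, hm, hlt⟩ := exists_mem_normalTuples_injective hx
  refine ⟨m, Tuple.sort (code m ∘ x), ?_, fun k hk h => hlt k hk ?_⟩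
  · rw [← Function.comp_assoc]
    exact (Tuple.monotone_sort _).strictMono_of_injective (hm.comp (Equiv.injective _))
  · rwa [← Function.comp_assoc, (Tuple.sort _).injective_comp] at h

theorem exists_forall_dist_lt_of_mem_normalTuples {m : ℕ} {x : Fin n → ErdosSpace}
    (hx : x ∈ normalTuples good m) {ε : ℝ} (hε : 0 < ε) :
    ∃ η > 0, ∀ x', dist x' x < η →
      x' ∈ normalTuples good m ∧ code m ∘ x' = code m ∘ x ∧ dist x' x < ε := by
  obtain ⟨η, hη, h⟩ := Metric.mem_nhds_iff.1 (inter_mem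
    ((isClopen_normalCell good (m, code m ∘ x)).isOpen.mem_nhds ⟨hx, rfl⟩) (Metric.ball_mem_nhds x hε))
  exact ⟨η, hη, fun y hy => ⟨(h hy).1.1, (h hy).1.2, (h hy).2⟩⟩

/-- Normal tuples all of whose members are close to a set of fewer than `n` points have high level
and small tails. -/
theorem exists_forall_normalTuples_small (hgood : ∀ c, good c → Function.Injective c)
    {a : Set ErdosSpace} (ha : a.encard < n) {ε : ℝ} (hε : 0 < ε) :
    ∃ η > 0, ∀ m, ∀ x ∈ normalTuples good m, (∀ j, ∃ y ∈ a, dist (x j) y < η) →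
      1 / ((m : ℝ) + 1) < ε ∧ ∀ j, tailNorm (m + 1) (x j) < ε := by
  have hfin : a.Finite := Set.finite_of_encard_le_coe ha.le
  obtain ⟨M, hM⟩ := eventually_atTop.1 ((tendsto_one_div_add_atTop_nhds_zero_nat.eventually
    (gt_mem_nhds hε)).and ((eventually_all_finite hfin).2 fun y _ =>
      (tendsto_tailNorm y).eventually (gt_mem_nhds (half_pos hε))))
  have hcode : ∀ᶠ η in 𝓝[>] (0 : ℝ), ∀ y ∈ a, ∀ k ∈ Finset.range M, ∀ z, dist z y < η →
      code k z = code k y := by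
    refine (eventually_all_finite hfin).2 fun y _ => (Finset.eventually_all _).2 fun k _ => ?_
    obtain ⟨η, hη, h⟩ := Metric.mem_nhds_iff.1 ((continuous_code k).continuousAt.preimage_mem_nhds
      ((isOpen_discrete {code k y}).mem_nhds rfl))
    filter_upwards [nhdsWithin_le_nhds (Iio_mem_nhds hη)] with η' hη' z hz
    exact h (hz.trans hη')
  obtain ⟨η, ⟨h1, h2⟩, h3⟩ := ((hcode.and (nhdsWithin_le_nhds (Iio_mem_nhds (half_pos hε)))).and
    self_mem_nhdsWithin).exists
  refine ⟨η, h3, fun m x hx hxa => ?_⟩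
  choose y hya hxy using hxa
  have hm : M ≤ m := by
    by_contra! hm
    have hinj : Function.Injective y := fun i j hij => by
      refine hgood _ hx.1 ?_
      simp only [Function.comp_apply]
      rw [h1 _ (hya i) m (Finset.mem_range.2 hm) _ (hxy i),
        h1 _ (hya j) m (Finset.mem_range.2 hm) _ (hxy j), hij]
    have h := Set.encard_le_encard (range_subset_iff.2 hya)
    rw [← image_univ, hinj.encard_image, encard_univ, ENat.card_eq_coe_fintype_card,
      Fintype.card_fin] at h
    exact absurd h ha.not_ge
  refine ⟨(hM m hm).1, fun j => ?_⟩
  have h4 := tailNorm_le_add_dist (m + 1) (x j) (y j)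
  have h5 := (hM (m + 1) (by omega)).2 _ (hya j)
  have h6 : η < ε / 2 := h2
  linarith [hxy j]

/-- The square of Erdős space has a collar over the diagonal. -/
theorem exists_collar_square :
    ∃ I : Type, Countable I ∧ Nonempty (Collar ErdosSpace (Fin 2 → ErdosSpace) I) := by
  let A : Set (Fin 2 → ErdosSpace) := {x | x 0 = x 1}
  have hA : ∀ x, x ∈ A ↔ ¬ Function.Injective x := fun x => by
    constructor
    · exact fun h hinj => absurd (hinj h) (by decide)
    · intro h
      simp only [Function.Injective, not_forall] at h
      obtain ⟨i, j, hij, hne⟩ := h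
      fin_cases i <;> fin_cases j <;> simp_all [A]
  have hgood : ∀ c : Fin 2 → ℕ, Function.Injective c → Function.Injective c := fun _ => id
  obtain ⟨I, hI, ⟨C⟩⟩ := exists_collar (n := 2) Function.Injective id (fun _ _ => le_rfl) (A := A)
    ⟨fun _ => origin, rfl⟩ (isClosed_eq (continuous_apply 0) (continuous_apply 1))
    (fun x _ => Metric.mem_closure_iff.2 fun ε hε => by
      obtain ⟨y, hy, h⟩ := exists_injective_dist_lt x hε
      exact ⟨y, fun h' => (hA y).1 h' hy, by rwa [dist_comm]⟩)
    (fun x => by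
      rw [hA, not_not]
      constructor
      · intro h
        obtain ⟨m, hm⟩ := exists_mem_normalTuples_injective h
        exact ⟨m, x, hm, rfl⟩
      · rintro ⟨m, x, hx, rfl⟩
        exact injective_of_mem_normalTuples hgood hx)
    (fun m x hx ε hε => by
      obtain ⟨η, hη, h⟩ := exists_forall_dist_lt_of_mem_normalTuples hx hε
      refine ⟨η, hη, fun m' x' hx' hd => ?_⟩
      obtain ⟨h1, h2, h3⟩ := h x' hd
      exact ⟨eq_of_mem_normalTuples hgood hx' h1, h2, h3⟩)
    (fun a ha ε hε => by
      obtain ⟨η, hη, h⟩ := exists_forall_normalTuples_small (a := {a 0}) hgood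
        (by rw [encard_singleton]; exact_mod_cast one_lt_two) hε
      refine ⟨η, hη, fun m x hx hd => h m x hx fun j => ⟨_, rfl, ?_⟩⟩
      have := (dist_le_pi_dist x a j).trans_lt hd
      fin_cases j
      · exact this
      · exact (show a 0 = a 1 from ha) ▸ this)
  refine ⟨I, hI, ⟨C.congr ⟨⟨fun x => x.1 0, fun e => ⟨fun _ => e, rfl⟩, fun x => ?_, fun e => rfl⟩,
    (continuous_apply 0).comp continuous_subtype_val,
    Continuous.subtype_mk (continuous_pi fun _ => continuous_id) _⟩⟩⟩
  refine Subtype.ext (funext fun j => ?_)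
  fin_cases j
  · rfl
  · exact x.2

/-- The nonempty subsets of Erdős space with at most `n` points, as a subspace of the hyperspace of
nonempty compact sets. -/
abbrev FinCompacts (n : ℕ) : Type :=
  {K : TopologicalSpace.NonemptyCompacts ErdosSpace // (K : Set ErdosSpace).encard ≤ n}

theorem encard_range_le (x : Fin n → ErdosSpace) : (range x).encard ≤ n := by
  rw [← image_univ]
  exact (encard_image_le _ _).trans (by simp)

theorem encard_range_eq_iff (x : Fin n → ErdosSpace) :
    (range x).encard = n ↔ Function.Injective x := by
  rw [← image_univ]
  constructor
  · intro h
    exact injOn_univ.1 (finite_univ.injOn_of_encard_image_eq (by simpa using h))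
  · intro h
    rw [h.encard_image]
    simp

section

variable [NeZero n]

/-- The set of members of a tuple. -/
def rangeCompacts (x : Fin n → ErdosSpace) : FinCompacts n :=
  ⟨⟨⟨range x, (finite_range x).isCompact⟩, range_nonempty x⟩, encard_range_le x⟩

theorem dist_rangeCompacts_le (x y : Fin n → ErdosSpace) :
    dist (rangeCompacts x) (rangeCompacts y) ≤ dist x y := by
  rw [Subtype.dist_eq, Metric.NonemptyCompacts.dist_eq]
  refine Metric.hausdorffDist_le_of_mem_dist dist_nonneg ?_ ?_
  · rintro _ ⟨j, rfl⟩
    exact ⟨y j, mem_range_self j, dist_le_pi_dist x y j⟩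
  · rintro _ ⟨j, rfl⟩
    exact ⟨x j, mem_range_self j, dist_comm x y ▸ dist_le_pi_dist y x j⟩

theorem surjective_rangeCompacts :
    Function.Surjective (rangeCompacts : (Fin n → ErdosSpace) → FinCompacts n) := by
  rintro ⟨K, hK⟩
  have hfin : Finite K := Set.finite_of_encard_le_coe hK
  have : Fintype K := Fintype.ofFinite K
  have hne : Nonempty K := K.nonempty.to_subtype
  have hcard : ((Fintype.card K : ℕ) : ℕ∞) ≤ n :=
    (ENat.card_eq_coe_fintype_card (α := K)).symm.le.trans hK
  obtain ⟨f⟩ := Function.Embedding.nonempty_of_card_le (α := K) (β := Fin n)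
    (by simpa using hcard)
  let g : Fin n → K := Function.invFun f
  refine ⟨fun j => (g j : ErdosSpace), Subtype.ext (TopologicalSpace.NonemptyCompacts.ext ?_)⟩
  exact ((Function.invFun_surjective f.injective).range_comp Subtype.val).trans Subtype.range_coe

end

theorem exists_mem_dist_lt {K L : TopologicalSpace.NonemptyCompacts ErdosSpace} {η : ℝ}
    (h : dist K L < η) {y : ErdosSpace} (hy : y ∈ K) : ∃ z ∈ L, dist y z < η := by
  rw [Metric.NonemptyCompacts.dist_eq] at h
  exact Metric.exists_dist_lt_of_hausdorffDist_lt hy h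
    (Metric.hausdorffEDist_ne_top_of_nonempty_of_bounded K.nonempty L.nonempty
      K.isCompact.isBounded L.isCompact.isBounded)

/-- Compact sets close to the set of members of an injective tuple contain a nearby injective
tuple. -/
theorem exists_injective_of_dist_lt [NeZero n] {x : Fin n → ErdosSpace} (hx : Function.Injective x)
    {ε : ℝ} (hε : 0 < ε) : ∃ η > 0, ∀ K : TopologicalSpace.NonemptyCompacts ErdosSpace,
      dist K (rangeCompacts x).1 < η →
        ∃ y : Fin n → ErdosSpace, Function.Injective y ∧ (∀ j, y j ∈ K) ∧ dist y x < ε := by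
  have h : ∀ᶠ η in 𝓝[>] (0 : ℝ), ∀ i j, i ≠ j → η < dist (x i) (x j) / 2 := by
    simp only [eventually_all]
    exact fun i j hij =>
      nhdsWithin_le_nhds (Iio_mem_nhds (half_pos (dist_pos.2 (hx.ne hij))))
  obtain ⟨η, ⟨h1, h2⟩, h3⟩ := ((h.and (nhdsWithin_le_nhds (Iio_mem_nhds hε))).and
    self_mem_nhdsWithin).exists
  refine ⟨η, h3, fun K hK => ?_⟩
  rw [dist_comm] at hK
  choose y hy hd using fun j => exists_mem_dist_lt hK (mem_range_self j)
  refine ⟨y, fun i j hij => by_contra fun hne => ?_, hy, (dist_pi_lt_iff hε).2 fun j => ?_⟩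
  · have h4 := dist_triangle_right (x i) (x j) (y i)
    have h5 := hd i
    have h6 := hd j
    rw [← hij] at h6
    linarith [h1 i j hne]
  · rw [dist_comm]
    exact (hd j).trans h2

/-- The space of sets with at most `n + 1` points has a collar over the space of sets with at most
`n` points. -/
theorem exists_collar_finCompacts (n : ℕ) (hn : 0 < n) :
    ∃ I : Type, Countable I ∧ Nonempty (Collar (FinCompacts n) (FinCompacts (n + 1)) I) := by
  let A : Set (FinCompacts (n + 1)) := {K | (K.1 : Set ErdosSpace).encard ≤ n}
  have hgood : ∀ c : Fin (n + 1) → ℕ, StrictMono c → Function.Injective c :=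
    fun _ h => h.injective
  have hA : ∀ x : Fin (n + 1) → ErdosSpace, rangeCompacts x ∉ A ↔ Function.Injective x := by
    intro x
    rw [← encard_range_eq_iff]
    have h : (range x).encard ≤ (n + 1 : ℕ) := encard_range_le x
    change ¬ (range x).encard ≤ n ↔ _
    rw [← (finite_range x).cast_ncard_eq] at h ⊢
    norm_cast at h ⊢
    omega
  obtain ⟨I, hI, ⟨C⟩⟩ := exists_collar (n := n + 1) StrictMono rangeCompacts dist_rangeCompacts_le
    (A := A)
    ⟨rangeCompacts fun _ => origin, by
      change (range fun _ : Fin (n + 1) => origin).encard ≤ n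
      rw [range_const, encard_singleton]
      exact_mod_cast hn⟩
    (by
      rw [← isOpen_compl_iff, Metric.isOpen_iff]
      intro K hK
      obtain ⟨x, rfl⟩ := surjective_rangeCompacts K
      obtain ⟨η, hη, h⟩ := exists_injective_of_dist_lt ((hA x).1 hK) one_pos
      refine ⟨η, hη, fun L hL hLA => ?_⟩
      obtain ⟨y, hy, hyL, -⟩ := h L.1 hL
      have h1 := (encard_range_eq_iff y).2 hy
      have h2 := (encard_le_encard (range_subset_iff.2 hyL)).trans hLA
      rw [h1] at h2
      exact absurd h2 (by exact_mod_cast n.lt_succ_self.not_ge))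
    (fun K _ => Metric.mem_closure_iff.2 fun ε hε => by
      obtain ⟨x, rfl⟩ := surjective_rangeCompacts K
      obtain ⟨y, hy, h⟩ := exists_injective_dist_lt x hε
      exact ⟨rangeCompacts y, (hA y).2 hy,
        (dist_rangeCompacts_le x y).trans_lt (by rwa [dist_comm])⟩)
    (fun K => by
      constructor
      · intro h
        obtain ⟨x, rfl⟩ := surjective_rangeCompacts K
        obtain ⟨m, σ, hm⟩ := exists_mem_normalTuples_strictMono ((hA x).1 h)
        refine ⟨m, _, hm, Subtype.ext (TopologicalSpace.NonemptyCompacts.ext ?_)⟩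
        exact σ.surjective.range_comp x
      · rintro ⟨m, x, hx, rfl⟩
        exact (hA x).2 (injective_of_mem_normalTuples hgood hx))
    (fun m x hx ε hε => by
      obtain ⟨ε', hε', h⟩ := exists_forall_dist_lt_of_mem_normalTuples hx hε
      obtain ⟨η, hη, h'⟩ :=
        exists_injective_of_dist_lt (injective_of_mem_normalTuples hgood hx) hε'
      refine ⟨η, hη, fun m' x' hx' hd => ?_⟩
      obtain ⟨y, hy, hyx', hyx⟩ := h' _ hd
      obtain ⟨h1, h2, h3⟩ := h y hyx
      choose τ hτ using hyx'
      obtain rfl : x' ∘ τ = y := funext hτ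
      have hτb : Function.Bijective τ := Finite.injective_iff_bijective.1 hy.of_comp
      have hinj : ∀ k, Function.Injective (code k ∘ x' ∘ τ) ↔ Function.Injective (code k ∘ x') :=
        fun k => by rw [← Function.comp_assoc]; exact (Equiv.ofBijective τ hτb).injective_comp _
      obtain rfl : m' = m :=
        le_antisymm (not_lt.1 fun hlt => hx'.2 _ hlt ((hinj m).1 (hgood _ h1.1)))
          (not_lt.1 fun hlt => h1.2 _ hlt ((hinj m').2 (hgood _ hx'.1)))
      have heq : code m' ∘ x' ∘ τ = code m' ∘ x' :=
        (h1.1.range_inj hx'.1).1 (by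
          rw [← Function.comp_assoc]; exact hτb.2.range_comp _)
      have hτ1 : τ = id := funext fun j => hgood _ hx'.1 (congrFun heq j)
      rw [hτ1, Function.comp_id] at h2 h3
      exact ⟨rfl, h2, h3⟩)
    (fun a ha ε hε => by
      obtain ⟨η, hη, h⟩ := exists_forall_normalTuples_small (a := (a.1 : Set ErdosSpace)) hgood
        (lt_of_le_of_lt ha (by exact_mod_cast n.lt_succ_self)) hε
      exact ⟨η, hη, fun m x hx hd => h m x hx fun j => exists_mem_dist_lt hd (mem_range_self j)⟩)
  exact ⟨I, hI, ⟨C.congr ⟨⟨fun K => ⟨K.1.1, K.2⟩,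
    fun K => ⟨⟨K.1, K.2.trans (by exact_mod_cast n.le_succ)⟩, K.2⟩, fun _ => rfl, fun _ => rfl⟩,
    by fun_prop, by fun_prop⟩⟩⟩

theorem nonempty_finCompacts_homeomorph (n : ℕ) : Nonempty (FinCompacts (n + 1) ≃ₜ ErdosSpace) := by
  induction n with
  | zero =>
    let f : ErdosSpace → FinCompacts 1 := fun e => ⟨{e}, by simp⟩
    have hf : Isometry f := fun x y => TopologicalSpace.NonemptyCompacts.isometry_singleton x y
    refine ⟨(IsometryEquiv.mk
      (Equiv.ofBijective f ⟨hf.injective, fun K => ?_⟩) hf).toHomeomorph.symm⟩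
    obtain ⟨e, he⟩ := encard_eq_one.1
      (le_antisymm (by simpa using K.2) (one_le_encard_iff_nonempty.2 K.1.nonempty))
    exact ⟨e, Subtype.ext (TopologicalSpace.NonemptyCompacts.ext he.symm)⟩
  | succ n ih =>
    obtain ⟨h⟩ := ih
    obtain ⟨I, _, ⟨C⟩⟩ := exists_collar_finCompacts (n + 1) n.succ_pos
    obtain ⟨J, _, ⟨D⟩⟩ := exists_collar_square
    obtain ⟨f⟩ := (C.congr h).nonempty_homeomorph D
    exact ⟨f.trans (powHomeomorph 2).symm⟩

end ErdosSpace

theorem vietoris_eq {X : Type*} [t : TopologicalSpace X] :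
    vietoris t = TopologicalSpace.vietoris X := by
  unfold vietoris TopologicalSpace.vietoris
  congr 1
  ext S
  simp only [mem_union, mem_image, mem_ofPred_eq]
  exact or_congr (exists_congr fun U => and_congr_right fun _ => eq_comm)
    (exists_congr fun U => and_congr_right fun _ => eq_comm)

/-- The hyperspace of sets with at most `n` points is a subspace of the hyperspace of compact
sets. -/
noncomputable def FinHypN.homeomorphFinCompacts (n : ℕ) :
    FinHypN n ErdosSpace ≃ₜ ErdosSpace.FinCompacts n := by
  let e : FinHypN n ErdosSpace ≃ ErdosSpace.FinCompacts n :=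
    { toFun F := ⟨⟨⟨F.1, (Set.finite_of_encard_le_coe F.2.2).isCompact⟩, F.2.1⟩, F.2.2⟩
      invFun K := ⟨K.1, K.1.nonempty, K.2⟩
      left_inv _ := rfl
      right_inv _ := rfl }
  refine e.toHomeomorphOfIsInducing ⟨?_⟩
  rw [FinHypN.instTopologicalSpace, vietoris_eq]
  have h : (instTopologicalSpaceSubtype : TopologicalSpace (ErdosSpace.FinCompacts n)) =
      (TopologicalSpace.vietoris ErdosSpace).induced
        ((SetLike.coe : TopologicalSpace.NonemptyCompacts ErdosSpace → Set ErdosSpace) ∘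
          Subtype.val) :=
    induced_compose (tγ := TopologicalSpace.vietoris ErdosSpace)
  rw [h, induced_compose]
  rfl

/-- For every `n ≥ 1`, the Vietoris hyperspace `ℱₙ(𝔈)` of nonempty subsets of Erdős space
`𝔈` of cardinality at most `n` is homeomorphic to `𝔈`. -/
theorem finHypN_erdosSpace_homeomorph_erdosSpace (n : ℕ) (hn : 0 < n) :
    Nonempty (FinHypN n ErdosSpace ≃ₜ ErdosSpace) := by
  obtain ⟨k, rfl⟩ := Nat.exists_eq_succ_of_ne_zero hn.ne'
  obtain ⟨f⟩ := ErdosSpace.nonempty_finCompacts_homeomorph k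
  exact ⟨(FinHypN.homeomorphFinCompacts _).trans f⟩
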